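/- arXiv:2402.13451 — 2 statements merged into one kernel-verified Lean document; each statement's English description precedes it below -/
import Mathlib

section
/- Let m, n be positive integers with m/n ∉ (1/2, 2) and (m,n) ∉ {(1,3),(3,1),(2,4),(4,2)}. Let ‖·‖₁ be any norm on ℝⁿ and ‖·‖₂ any norm on ℝᵐ. Then dim_H FS_{m,n}(‖·‖₁,‖·‖₂) ≥ mn − 2·min{m,n}. Moreover the same bound holds restricting to matrices Ω that (i) have full ℝ-rank min{m,n} and (ii) whose entries together with 1 form a ℚ-linearly independent set, and the Dirichlet spectrum {Θ(Ω) : Ω ∈ ℝ^{m×n}} accumulates at 0, in particular it is not finite. -/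
open Filter MeasureTheory
open scoped ENNReal

/-- `N` is a norm on `ℝ^k` (viewed as `Fin k → ℝ`). -/
def IsNorm {k : ℕ} (N : (Fin k → ℝ) → ℝ) : Prop :=
  (∀ x, N x = 0 ↔ x = 0) ∧ (∀ (c : ℝ) (x : Fin k → ℝ), N (c • x) = |c| * N x) ∧
    ∀ x y, N (x + y) ≤ N x + N y

/-- The best approximation function `ψ_Ω(‖·‖₁,‖·‖₂,t)` of an `m × n` matrix `Ω`. -/
noncomputable def psiGen (m n : ℕ) (N1 : (Fin n → ℝ) → ℝ) (N2 : (Fin m → ℝ) → ℝ)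
    (Ω : Fin m → Fin n → ℝ) (t : ℝ) : ℝ :=
  sInf { r : ℝ | ∃ (bh : Fin n → ℤ) (bt : Fin m → ℤ),
    1 ≤ N1 (fun i => (bh i : ℝ)) ∧ N1 (fun i => (bh i : ℝ)) ≤ t ∧
    r = N2 (fun j => (∑ i, Ω j i * (bh i : ℝ)) + (bt j : ℝ)) }

/-- `Θ(Ω) = limsup_{t→∞} t^{n/m} ψ_Ω(t)`. -/
noncomputable def ThetaGen (m n : ℕ) (N1 : (Fin n → ℝ) → ℝ) (N2 : (Fin m → ℝ) → ℝ)
    (Ω : Fin m → Fin n → ℝ) : ℝ :=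
  limsup (fun t : ℝ => t ^ ((n : ℝ) / (m : ℝ)) * psiGen m n N1 N2 Ω t) atTop

/-- `Θ̃(Ω) = liminf_{t→∞} t^{n/m} ψ_Ω(t)`. -/
noncomputable def ThetaTildeGen (m n : ℕ) (N1 : (Fin n → ℝ) → ℝ) (N2 : (Fin m → ℝ) → ℝ)
    (Ω : Fin m → Fin n → ℝ) : ℝ :=
  liminf (fun t : ℝ => t ^ ((n : ℝ) / (m : ℝ)) * psiGen m n N1 N2 Ω t) atTop

/-- `D = sup_Ω Θ(Ω)`. -/
noncomputable def DirichletSup (m n : ℕ) (N1 : (Fin n → ℝ) → ℝ)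
    (N2 : (Fin m → ℝ) → ℝ) : ℝ :=
  ⨆ Ω : Fin m → Fin n → ℝ, ThetaGen m n N1 N2 Ω

/-- `FS_{m,n}(‖·‖₁,‖·‖₂) = Di_{m,n}(‖·‖₁,‖·‖₂) \ (Bad_{m,n} ∪ Sing_{m,n})`. -/
def FSset (m n : ℕ) (N1 : (Fin n → ℝ) → ℝ) (N2 : (Fin m → ℝ) → ℝ) :
    Set (Fin m → Fin n → ℝ) :=
  {Ω | ThetaGen m n N1 N2 Ω < DirichletSup m n N1 N2} \
    ({Ω | 0 < ThetaTildeGen m n N1 N2 Ω} ∪ {Ω | ThetaGen m n N1 N2 Ω = 0})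

/-- The entries of `Ω`, together with `1`, form a `ℚ`-linearly independent family. -/
def QIndepEntries (m n : ℕ) (Ω : Fin m → Fin n → ℝ) : Prop :=
  LinearIndependent ℚ
    (fun o : Option (Fin m × Fin n) => o.elim (1 : ℝ) (fun p => Ω p.1 p.2))

section Baire

variable {U V : Type*} [NormedAddCommGroup U] [NormedAddCommGroup V]

/-- Lipschitz dependence on the parameter, uniformly over times bounded above. -/
def LipOnTimes {W : Type*} [PseudoMetricSpace W] (g : W → ℝ → ℝ) : Prop :=
  ∀ b : ℝ, ∃ K : ℝ, 0 < K ∧ ∀ w₁ w₂ t, t ≤ b → |g w₁ t - g w₂ t| ≤ K * dist w₁ w₂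

/-- `g (u, v) t` tends to `0` as `t → ∞` (from above), uniformly in `v`. -/
def VanishesUniformly {U V : Type*} (g : U × V → ℝ → ℝ) (u : U) : Prop :=
  ∀ δ > 0, ∃ T : ℝ, ∀ v, ∀ t ≥ T, g (u, v) t ≤ δ

/-- `g w` stays below some constant smaller than `e` from time `T₀` on. -/
def StrictlyBelow {W : Type*} (g : W → ℝ → ℝ) (T₀ e : ℝ) (w : W) : Prop :=
  ∃ e' < e, ∀ t ≥ T₀, g w t ≤ e'

lemma LipOnTimes.continuous {W : Type*} [PseudoMetricSpace W] {g : W → ℝ → ℝ}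
    (hg : LipOnTimes g) (t : ℝ) : Continuous fun w => g w t := by
  obtain ⟨K, hK, h⟩ := hg t
  refine (LipschitzWith.of_dist_le_mul (K := ⟨K, hK.le⟩) fun w w' => ?_).continuous
  rw [Real.dist_eq]
  exact h w w' t le_rfl

lemma LipOnTimes.swap {g : U × V → ℝ → ℝ} (hg : LipOnTimes g) :
    LipOnTimes fun w : V × U => g w.swap := by
  intro b
  obtain ⟨K, hK, h⟩ := hg b
  refine ⟨K, hK, fun w w' t ht => (h _ _ t ht).trans_eq ?_⟩
  simp [Prod.dist_eq, max_comm]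

/-- Near a point `(u₀, v₀)` that is strictly below `e`, the function stays strictly below `e`
on bounded time windows. -/
lemma LipOnTimes.exists_ball {W : Type*} [PseudoMetricSpace W] {g : W → ℝ → ℝ}
    (hg : LipOnTimes g) {T₀ e : ℝ} {w₀ : W} (h : StrictlyBelow g T₀ e w₀) (T₁ : ℝ) :
    ∃ e₁ < e, ∃ η > 0, ∀ w, dist w w₀ < η → ∀ t ≥ T₀, t ≤ T₁ → g w t ≤ e₁ := by
  obtain ⟨e', he', h⟩ := h
  obtain ⟨K, hK, hL⟩ := hg T₁
  refine ⟨(e' + e) / 2, by linarith, (e - e') / 2 / K, by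
    apply div_pos _ hK; linarith, fun w hw t ht ht' => ?_⟩
  have h1 := hL w w₀ t ht'
  have h2 := h t ht
  have h3 : K * dist w w₀ < (e - e') / 2 := by
    rw [lt_div_iff₀ hK] at hw; linarith
  have := abs_le.1 h1
  linarith

lemma StrictlyBelow.eventually {g : U × V → ℝ → ℝ} (hg : LipOnTimes g) {T₀ e : ℝ} (he : 0 < e)
    {u₀ : U} {v₀ : V} (hu : VanishesUniformly g u₀) (h : StrictlyBelow g T₀ e (u₀, v₀)) :
    ∃ η > 0, ∀ v, dist v v₀ < η → StrictlyBelow g T₀ e (u₀, v) := by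
  obtain ⟨T₁, hT₁⟩ := hu (e / 2) (by linarith)
  obtain ⟨e₁, he₁, η, hη, h⟩ := hg.exists_ball h T₁
  refine ⟨η, hη, fun v hv => ⟨max e₁ (e / 2), max_lt he₁ (by linarith), fun t ht => ?_⟩⟩
  rcases le_total t T₁ with h' | h'
  · exact (h (u₀, v) (by simp [Prod.dist_eq, hv]) t ht h').trans (le_max_left _ _)
  · exact (hT₁ v t h').trans (le_max_right _ _)

/-- The key perturbation step: a discrete intermediate value argument along a segment. -/
lemma StrictlyBelow.exists_near [NormedSpace ℝ U] {g : U × V → ℝ → ℝ} (hg : LipOnTimes g) {T₀ e c : ℝ} (he : 0 < e)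
    (hec : e ≤ c) (hQ : Dense {v | VanishesUniformly (fun w : V × U => g w.swap) v})
    (hc : Dense {w | ∀ N : ℝ, ∃ t ≥ N, c < g w t})
    {u₀ : U} {v₀ : V} (hu : VanishesUniformly g u₀) (h : StrictlyBelow g T₀ e (u₀, v₀))
    {η : ℝ} (hη : 0 < η) (N : ℝ) :
    ∃ w : U × V, dist w (u₀, v₀) < η ∧ VanishesUniformly (fun w : V × U => g w.swap) w.2 ∧
      StrictlyBelow g T₀ e w ∧ ∃ t ≥ N, e / 2 < g w t := by
  obtain ⟨T₁', hT₁'⟩ := hu (e / 4) (by linarith)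
  set T₁ := max T₁' N with hT₁def
  have hT₁ : ∀ v, ∀ t ≥ T₁, g (u₀, v) t ≤ e / 4 := fun v t ht =>
    hT₁' v t ((le_max_left _ _).trans ht)
  obtain ⟨e₁, he₁, η₁, hη₁, hball⟩ := hg.exists_ball h T₁
  set ρ := min η η₁ with hρ
  have hρ0 : 0 < ρ := lt_min hη hη₁
  obtain ⟨⟨us, vs⟩, hws, hlarge⟩ := Metric.dense_iff.1 hc (u₀, v₀) ρ hρ0
  obtain ⟨ts, hts, hgt⟩ := hlarge T₁
  have hopen : IsOpen {v : V | c < g (us, v) ts ∧ dist v v₀ < ρ} := by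
    refine IsOpen.inter ?_ ?_
    · exact isOpen_lt continuous_const ((hg.continuous ts).comp (Continuous.prodMk continuous_const continuous_id))
    · exact isOpen_lt (continuous_id.dist continuous_const) continuous_const
  rw [Metric.mem_ball, Prod.dist_eq] at hws
  obtain ⟨v₁, ⟨hv₁, hv₁'⟩, hv₁Q⟩ := hQ.inter_open_nonempty _ hopen
    ⟨vs, hgt, (le_max_right _ _).trans_lt hws⟩
  obtain ⟨T₂', hT₂'⟩ := hv₁Q (e / 4) (by linarith)
  set T₂ := max T₂' ts with hT₂def
  have hT₂ : ∀ u, ∀ t ≥ T₂, g (u, v₁) t ≤ e / 4 := fun u t ht =>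
    hT₂' u t ((le_max_left _ _).trans ht)
  obtain ⟨K, hK, hL⟩ := hg T₂
  obtain ⟨M, hM⟩ := exists_nat_gt (K * dist us u₀ / (e / 4))
  have hM0 : (0 : ℝ) < M := lt_of_le_of_lt (by positivity) hM
  let path : ℕ → U := fun k => u₀ + ((k : ℝ) / M) • (us - u₀)
  have hstep : ∀ k, dist (path (k + 1)) (path k) = dist us u₀ / M := by
    intro k
    have : path (k + 1) - path k = (1 / (M : ℝ)) • (us - u₀) := by
      simp only [path, add_sub_add_left_eq_sub, ← sub_smul]
      congr 1
      push_cast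
      ring
    rw [dist_eq_norm, this, norm_smul, dist_eq_norm, Real.norm_of_nonneg (by positivity)]
    ring
  have hdist : ∀ k ≤ M, dist (path k) u₀ ≤ dist us u₀ := by
    intro k hk
    rw [dist_eq_norm, dist_eq_norm, show path k - u₀ = ((k : ℝ) / M) • (us - u₀) by simp [path],
      norm_smul, Real.norm_of_nonneg (by positivity)]
    refine mul_le_of_le_one_left (norm_nonneg _) ((div_le_one hM0).2 (by exact_mod_cast hk))
  have hex : ∃ k, ∃ t ≥ T₁, e / 2 < g (path k, v₁) t := by
    refine ⟨M, ts, hts, ?_⟩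
    have : path M = us := by simp [path, hM0.ne']
    rw [this]
    linarith
  classical
  let k := Nat.find hex
  have hkM : k ≤ M := Nat.find_min' hex ⟨ts, hts, by
    have : path M = us := by simp [path, hM0.ne']
    rw [this]
    linarith⟩
  obtain ⟨t₀, ht₀, hgt₀⟩ := Nat.find_spec hex
  have hk0 : k ≠ 0 := by
    intro h0
    have h1 := hT₁ v₁ t₀ ht₀
    have h2 : path k = u₀ := by simp [path, h0]
    have h3 : e / 2 < g (path k, v₁) t₀ := hgt₀
    rw [h2] at h3
    linarith
  obtain ⟨l, hl⟩ := Nat.exists_eq_succ_of_ne_zero hk0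
  have hlmin : ∀ t ≥ T₁, g (path l, v₁) t ≤ e / 2 := by
    intro t ht
    by_contra! hcon
    exact Nat.find_min hex (show l < k by omega) ⟨t, ht, hcon⟩
  have hupper : ∀ t ≥ T₁, g (path k, v₁) t ≤ 3 * e / 4 := by
    intro t ht
    rcases le_total t T₂ with h' | h'
    · have h1 := abs_le.1 (hL (path k, v₁) (path l, v₁) t h')
      have h2 : dist (path k, v₁) (path l, v₁) = dist us u₀ / M := by
        rw [Prod.dist_eq, hl, hstep]; simp; positivity
      rw [h2] at h1
      have h3 : K * (dist us u₀ / M) < e / 4 := by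
        rw [div_lt_iff₀ (by linarith)] at hM
        rw [← mul_div_assoc, div_lt_iff₀ hM0]
        linarith
      have := hlmin t ht
      linarith
    · exact (hT₂ _ t h').trans (by linarith)
  have hnear : dist (path k, v₁) (u₀, v₀) < ρ := by
    rw [Prod.dist_eq]
    exact max_lt ((hdist k hkM).trans_lt ((le_max_left _ _).trans_lt hws)) hv₁'
  refine ⟨(path k, v₁), hnear.trans_le (min_le_left _ _), hv₁Q,
    ⟨max e₁ (3 * e / 4), max_lt he₁ (by linarith), fun t ht => ?_⟩,
    t₀, (le_max_right _ _).trans ht₀, hgt₀⟩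
  rcases le_total t T₁ with h' | h'
  · exact (hball _ (hnear.trans_le (min_le_right _ _)) t ht h').trans (le_max_left _ _)
  · exact (hupper t h').trans (le_max_right _ _)

/-- Avoiding a closed set whose complement has dense slices in one of the two directions. -/
lemma StrictlyBelow.exists_near_notMem {g : U × V → ℝ → ℝ} (hg : LipOnTimes g) {T₀ e : ℝ}
    (he : 0 < e) (hQ : Dense {v | VanishesUniformly (fun w : V × U => g w.swap) v})
    {F : Set (U × V)} (hF : (∀ u, Dense {v | (u, v) ∉ F}) ∨ ∀ v, Dense {u | (u, v) ∉ F})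
    {u₀ : U} {v₀ : V} (hu : VanishesUniformly g u₀) (h : StrictlyBelow g T₀ e (u₀, v₀))
    {η : ℝ} (hη : 0 < η) :
    ∃ w : U × V, dist w (u₀, v₀) < η ∧
      (VanishesUniformly g w.1 ∨ VanishesUniformly (fun w : V × U => g w.swap) w.2) ∧
      StrictlyBelow g T₀ e w ∧ w ∉ F := by
  obtain ⟨ρ, hρ, hst⟩ := h.eventually hg he hu
  rcases hF with hF | hF
  · obtain ⟨v, hv, hvF⟩ := Metric.dense_iff.1 (hF u₀) v₀ (min ρ η) (lt_min hρ hη)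
    rw [Metric.mem_ball] at hv
    refine ⟨(u₀, v), ?_, .inl hu, hst v (hv.trans_le (min_le_left _ _)), hvF⟩
    simpa [Prod.dist_eq, hη] using hv.trans_le (min_le_right _ _)
  · obtain ⟨v, hv, hvQ⟩ := Metric.dense_iff.1 hQ v₀ (min ρ η) (lt_min hρ hη)
    rw [Metric.mem_ball] at hv
    have hs : StrictlyBelow (fun w : V × U => g w.swap) T₀ e (v, u₀) :=
      hst v (hv.trans_le (min_le_left _ _))
    obtain ⟨ρ', hρ', hst'⟩ := hs.eventually hg.swap he hvQ
    obtain ⟨u, hu', huF⟩ := Metric.dense_iff.1 (hF v) u₀ (min ρ' η) (lt_min hρ' hη)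
    rw [Metric.mem_ball] at hu'
    refine ⟨(u, v), ?_, .inr hvQ, hst' u (hu'.trans_le (min_le_left _ _)), huF⟩
    rw [Prod.dist_eq]
    exact max_lt (hu'.trans_le (min_le_right _ _)) (hv.trans_le (min_le_right _ _))

/-- If every point of `S` is a limit of points of `S ∩ O`, then `O` is dense in `closure S`. -/
lemma dense_preimage_closure {W : Type*} [PseudoMetricSpace W] {S O : Set W}
    (h : ∀ s ∈ S, ∀ η > 0, ∃ w, dist w s < η ∧ w ∈ S ∧ w ∈ O) :
    Dense ((↑) ⁻¹' O : Set (closure S)) := by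
  rw [Subtype.dense_iff, Subtype.image_preimage_coe]
  refine closure_minimal (fun s hs => Metric.mem_closure_iff.2 fun η hη => ?_) isClosed_closure
  obtain ⟨w, hw, hwS, hwO⟩ := h s hs η hη
  exact ⟨w, ⟨subset_closure hwS, hwO⟩, by rwa [dist_comm]⟩

/-- Baire category construction of parameters for which `g` oscillates between `0` and `e`. -/
theorem exists_oscillating [NormedSpace ℝ U] [NormedSpace ℝ V] [CompleteSpace U] [CompleteSpace V] {ι : Type*} [Countable ι]
    {g : U × V → ℝ → ℝ} (hg : LipOnTimes g) {e c : ℝ} (he : 0 < e) (hec : e ≤ c)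
    (hP : Dense {u | VanishesUniformly g u})
    (hQ : Dense {v | VanishesUniformly (fun w : V × U => g w.swap) v})
    (hc : Dense {w | ∀ N : ℝ, ∃ t ≥ N, c < g w t})
    {F : ι → Set (U × V)} (hFc : ∀ i, IsClosed (F i))
    (hF : ∀ i, (∀ u, Dense {v | (u, v) ∉ F i}) ∨ ∀ v, Dense {u | (u, v) ∉ F i}) :
    ∃ w, (∃ T : ℝ, ∀ t ≥ T, g w t ≤ e) ∧ (∀ N : ℝ, ∃ t ≥ N, e / 2 < g w t) ∧
      (∀ δ > 0, ∀ N : ℝ, ∃ t ≥ N, g w t < δ) ∧ ∀ i, w ∉ F i := by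
  obtain ⟨u₀, hu₀⟩ := hP.nonempty
  obtain ⟨T₀, hT₀⟩ := hu₀ (e / 2) (by linarith)
  set S : Set (U × V) := {w | (VanishesUniformly g w.1 ∨
    VanishesUniformly (fun w : V × U => g w.swap) w.2) ∧ StrictlyBelow g T₀ e w} with hS
  have hS0 : (u₀, (0 : V)) ∈ S := ⟨.inl hu₀, e / 2, by linarith, hT₀ 0⟩
  have hc' : Dense {w : V × U | ∀ N : ℝ, ∃ t ≥ N, c < g w.swap t} := by
    have := hc.preimage (Homeomorph.prodComm V U).isOpenMap
    exact this
  have hP' : Dense {u | VanishesUniformly (fun w : U × V => g w.swap.swap) u} := hP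
  have hdistswap : ∀ (w : V × U) (u : U) (v : V), dist w.swap (u, v) = dist w (v, u) := by
    intro w u v
    simp [Prod.dist_eq, max_comm]
  have hdenseA : ∀ N : ℕ, Dense ((↑) ⁻¹' {w | ∃ t ≥ (N : ℝ), e / 2 < g w t} :
      Set (closure S)) := by
    refine fun N => dense_preimage_closure ?_
    rintro ⟨u, v⟩ ⟨hu | hv, hst⟩ η hη
    · obtain ⟨w, hw, hwQ, hws, hwt⟩ := hst.exists_near hg he hec hQ hc hu hη N
      exact ⟨w, hw, ⟨.inr hwQ, hws⟩, hwt⟩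
    · obtain ⟨w, hw, hwQ, hws, hwt⟩ := StrictlyBelow.exists_near (u₀ := v) (v₀ := u)
        hg.swap he hec hP' hc' hv hst hη N
      exact ⟨w.swap, by rwa [hdistswap], ⟨.inl hwQ, hws⟩, hwt⟩
  have hdenseB : ∀ N : ℕ, Dense ((↑) ⁻¹' {w | ∃ t ≥ (N : ℝ), g w t < 1 / (N + 1)} :
      Set (closure S)) := by
    refine fun N => dense_preimage_closure ?_
    rintro ⟨u, v⟩ ⟨huv, hst⟩ η hη
    refine ⟨(u, v), by simpa, ⟨huv, hst⟩, ?_⟩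
    have hpos : (0 : ℝ) < 1 / (N + 1) / 2 := by positivity
    rcases huv with hu | hv
    · obtain ⟨T, hT⟩ := hu _ hpos
      exact ⟨max T N, le_max_right _ _, (hT v _ (le_max_left _ _)).trans_lt (by linarith)⟩
    · obtain ⟨T, hT⟩ := hv _ hpos
      exact ⟨max T N, le_max_right _ _, (hT u _ (le_max_left _ _)).trans_lt (by linarith)⟩
  have hdenseC : ∀ i, Dense ((↑) ⁻¹' (F i)ᶜ : Set (closure S)) := by
    refine fun i => dense_preimage_closure ?_
    rintro ⟨u, v⟩ ⟨hu | hv, hst⟩ η hη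
    · obtain ⟨w, hw, hwQ, hws, hwt⟩ := hst.exists_near_notMem hg he hQ (hF i) hu hη
      exact ⟨w, hw, ⟨hwQ, hws⟩, hwt⟩
    · obtain ⟨w, hw, hwQ, hws, hwt⟩ := StrictlyBelow.exists_near_notMem (u₀ := v) (v₀ := u)
        (F := Prod.swap ⁻¹' F i) hg.swap he hP' (hF i).symm hv hst hη
      exact ⟨w.swap, by rwa [hdistswap], ⟨hwQ.symm, hws⟩, hwt⟩
  have hopenA : ∀ N : ℕ, IsOpen {w | ∃ t ≥ (N : ℝ), e / 2 < g w t} := by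
    intro N
    simp only [Set.ofPred_exists, ge_iff_le, Set.ofPred_and]
    exact isOpen_iUnion fun t => isOpen_const.inter (isOpen_lt continuous_const (hg.continuous t))
  have hopenB : ∀ N : ℕ, IsOpen {w | ∃ t ≥ (N : ℝ), g w t < 1 / (N + 1)} := by
    intro N
    simp only [Set.ofPred_exists, ge_iff_le, Set.ofPred_and]
    exact isOpen_iUnion fun t => isOpen_const.inter (isOpen_lt (hg.continuous t) continuous_const)
  let O : ℕ ⊕ ℕ ⊕ ι → Set (U × V) := Sum.elim (fun N => {w | ∃ t ≥ (N : ℝ), e / 2 < g w t})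
    (Sum.elim (fun N => {w | ∃ t ≥ (N : ℝ), g w t < 1 / (N + 1)}) fun i => (F i)ᶜ)
  have hO : ∀ j, IsOpen (O j) := by
    rintro (N | N | i)
    exacts [hopenA N, hopenB N, (hFc i).isOpen_compl]
  have hOd : ∀ j, Dense ((↑) ⁻¹' O j : Set (closure S)) := by
    rintro (N | N | i)
    exacts [hdenseA N, hdenseB N, hdenseC i]
  have : CompleteSpace (closure S) := isClosed_closure.completeSpace_coe
  have : Nonempty (closure S) := ⟨⟨_, subset_closure hS0⟩⟩
  obtain ⟨⟨w, hwS⟩, hw⟩ := (dense_iInter_of_isOpen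
    (fun j => (hO j).preimage continuous_subtype_val) hOd).nonempty
  simp only [Set.mem_iInter, Set.mem_preimage] at hw
  refine ⟨w, ⟨T₀, fun t ht => ?_⟩, fun N => ?_, fun δ hδ N => ?_, fun i => hw (.inr (.inr i))⟩
  · have hcl : IsClosed {w | g w t ≤ e} := isClosed_le (hg.continuous t) continuous_const
    refine closure_minimal ?_ hcl hwS
    rintro w ⟨-, e', he', hw'⟩
    exact (hw' t ht).trans he'.le
  · obtain ⟨k, hk⟩ := exists_nat_gt N
    obtain ⟨t, ht, hgt⟩ := hw (.inl k)
    exact ⟨t, hk.le.trans ht, hgt⟩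
  · obtain ⟨k, hk⟩ := exists_nat_gt (max N (1 / δ))
    obtain ⟨t, ht, hgt⟩ := hw (.inr (.inl k))
    refine ⟨t, ((le_max_left _ _).trans hk.le).trans ht, hgt.trans ?_⟩
    rw [one_div_lt (by positivity) hδ]
    linarith [le_max_right N (1 / δ)]

end Baire

section Norms

lemma IsNorm.nonneg {k : ℕ} {N : (Fin k → ℝ) → ℝ} (h : IsNorm N) (x : Fin k → ℝ) : 0 ≤ N x := by
  have h1 := h.2.2 x ((-1 : ℝ) • x)
  have h2 := h.2.1 (-1) x
  have h3 : N (x + (-1 : ℝ) • x) = 0 := (h.1 _).2 (by simp)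
  rw [h2, h3] at h1
  simp at h1
  linarith

lemma IsNorm.exists_le {k : ℕ} {N : (Fin k → ℝ) → ℝ} (h : IsNorm N) :
    ∃ C > 0, ∀ x, N x ≤ C * ‖x‖ := by
  have hsum : ∀ (s : Finset (Fin k)) (f : Fin k → Fin k → ℝ),
      N (∑ i ∈ s, f i) ≤ ∑ i ∈ s, N (f i) := by
    intro s f
    classical
    induction s using Finset.induction_on with
    | empty => simp [(h.1 0).2 rfl]
    | insert a s ha ih =>
      rw [Finset.sum_insert ha, Finset.sum_insert ha]
      exact (h.2.2 _ _).trans (by linarith)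
  refine ⟨∑ i, N (Pi.single i 1) + 1, ?_, fun x => ?_⟩
  · have := Finset.sum_nonneg fun i (_ : i ∈ Finset.univ) => h.nonneg (Pi.single i (1 : ℝ))
    linarith
  · have hx : x = ∑ i, x i • (Pi.single i (1 : ℝ) : Fin k → ℝ) := by
      ext j
      simp [Finset.sum_apply, Pi.single_apply]
    calc N x = N (∑ i, x i • (Pi.single i (1 : ℝ) : Fin k → ℝ)) := by rw [← hx]
      _ ≤ ∑ i, N (x i • (Pi.single i (1 : ℝ) : Fin k → ℝ)) := hsum _ _
      _ ≤ ∑ i, ‖x‖ * N (Pi.single i 1) := by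
        refine Finset.sum_le_sum fun i _ => ?_
        rw [h.2.1]
        exact mul_le_mul_of_nonneg_right (norm_le_pi_norm x i) (h.nonneg _)
      _ ≤ (∑ i, N (Pi.single i 1) + 1) * ‖x‖ := by
        rw [← Finset.mul_sum]
        nlinarith [norm_nonneg x]

lemma IsNorm.exists_ge {k : ℕ} {N : (Fin k → ℝ) → ℝ} (h : IsNorm N) :
    ∃ c > 0, ∀ x, c * ‖x‖ ≤ N x := by
  obtain ⟨C, hC, hle⟩ := h.exists_le
  have hcont : Continuous N := by
    refine (LipschitzWith.of_dist_le_mul (K := ⟨C, hC.le⟩) fun x y => ?_).continuous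
    have h1 := h.2.2 (x - y) y
    have h2 := h.2.2 (y - x) x
    have h3 := hle (x - y)
    have h4 := hle (y - x)
    rw [sub_add_cancel] at h1 h2
    rw [norm_sub_rev] at h4
    rw [Real.dist_eq, dist_eq_norm]
    exact abs_le.2 ⟨by change -(C * _) ≤ _; linarith, by change _ ≤ C * _; linarith⟩
  rcases (Metric.sphere (0 : Fin k → ℝ) 1).eq_empty_or_nonempty with he | hne
  · refine ⟨1, one_pos, fun x => ?_⟩
    have : x = 0 := by
      by_contra hx
      have : ‖x‖⁻¹ • x ∈ Metric.sphere (0 : Fin k → ℝ) 1 := by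
        simp [norm_smul, hx]
      rw [he] at this
      exact this
    subst this
    simp [h.nonneg]
  · obtain ⟨x₀, hx₀, hmin⟩ := (isCompact_sphere (0 : Fin k → ℝ) 1).exists_isMinOn hne
      hcont.continuousOn
    have hx₀' : x₀ ≠ 0 := by
      rintro rfl
      simp at hx₀
    refine ⟨N x₀, lt_of_le_of_ne (h.nonneg _) (fun h0 => hx₀' ((h.1 _).1 h0.symm)), fun x => ?_⟩
    rcases eq_or_ne x 0 with rfl | hx
    · simp [h.nonneg]
    · have hx' : (0 : ℝ) < ‖x‖ := norm_pos_iff.2 hx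
      have h1 : N x₀ ≤ N (‖x‖⁻¹ • x) := hmin (by simp [norm_smul, hx])
      rw [h.2.1, abs_of_nonneg (by positivity), inv_mul_eq_div, le_div_iff₀ hx'] at h1
      exact h1

lemma one_le_norm_intCast {k : ℕ} {b : Fin k → ℤ} (hb : b ≠ 0) :
    1 ≤ ‖fun i => (b i : ℝ)‖ := by
  obtain ⟨i, hi⟩ := Function.ne_iff.1 hb
  refine le_trans ?_ (norm_le_pi_norm (fun i => (b i : ℝ)) i)
  rw [Real.norm_eq_abs]
  exact_mod_cast Int.one_le_abs hi

end Norms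

section Psi

variable {m n : ℕ} {N1 : (Fin n → ℝ) → ℝ} {N2 : (Fin m → ℝ) → ℝ}

/-- The function `t ↦ t^{n/m} ψ_Ω(t)`. -/
noncomputable def scaledPsi (m n : ℕ) (N1 : (Fin n → ℝ) → ℝ) (N2 : (Fin m → ℝ) → ℝ)
    (Ω : Fin m → Fin n → ℝ) (t : ℝ) : ℝ :=
  t ^ ((n : ℝ) / (m : ℝ)) * psiGen m n N1 N2 Ω t

lemma psiGen_nonneg (hN2 : IsNorm N2) (Ω : Fin m → Fin n → ℝ) (t : ℝ) :
    0 ≤ psiGen m n N1 N2 Ω t := by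
  refine Real.sInf_nonneg ?_
  rintro r ⟨bh, bt, -, -, rfl⟩
  exact hN2.nonneg _

lemma psiGen_le (hN2 : IsNorm N2) (Ω : Fin m → Fin n → ℝ) {t : ℝ} (bh : Fin n → ℤ)
    (bt : Fin m → ℤ) (h1 : 1 ≤ N1 (fun i => (bh i : ℝ))) (h2 : N1 (fun i => (bh i : ℝ)) ≤ t) :
    psiGen m n N1 N2 Ω t ≤ N2 (fun j => (∑ i, Ω j i * (bh i : ℝ)) + (bt j : ℝ)) := by
  refine csInf_le ⟨0, ?_⟩ ⟨bh, bt, h1, h2, rfl⟩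
  rintro r ⟨bh, bt, -, -, rfl⟩
  exact hN2.nonneg _

lemma scaledPsi_nonneg (hN2 : IsNorm N2) (Ω : Fin m → Fin n → ℝ) {t : ℝ} (ht : 0 ≤ t) :
    0 ≤ scaledPsi m n N1 N2 Ω t :=
  mul_nonneg (Real.rpow_nonneg ht _) (psiGen_nonneg hN2 Ω t)

lemma psiGen_le_add (hN2 : IsNorm N2) {c₁ C₂ : ℝ} (hc₁ : 0 < c₁) (hC₂ : 0 < C₂)
    (h₁ : ∀ x, c₁ * ‖x‖ ≤ N1 x) (h₂ : ∀ x, N2 x ≤ C₂ * ‖x‖) (Ω Ω' : Fin m → Fin n → ℝ)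
    {t : ℝ} (ht : 0 ≤ t) :
    psiGen m n N1 N2 Ω t ≤ psiGen m n N1 N2 Ω' t + C₂ * (n * (t / c₁)) * dist Ω Ω' := by
  rcases Set.eq_empty_or_nonempty { r : ℝ | ∃ (bh : Fin n → ℤ) (bt : Fin m → ℤ),
    1 ≤ N1 (fun i => (bh i : ℝ)) ∧ N1 (fun i => (bh i : ℝ)) ≤ t ∧
    r = N2 (fun j => (∑ i, Ω' j i * (bh i : ℝ)) + (bt j : ℝ)) } with he | hne
  · have he' : { r : ℝ | ∃ (bh : Fin n → ℤ) (bt : Fin m → ℤ),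
        1 ≤ N1 (fun i => (bh i : ℝ)) ∧ N1 (fun i => (bh i : ℝ)) ≤ t ∧
        r = N2 (fun j => (∑ i, Ω j i * (bh i : ℝ)) + (bt j : ℝ)) } = ∅ := by
      rw [Set.eq_empty_iff_forall_notMem] at he ⊢
      rintro r ⟨bh, bt, h1, h2, -⟩
      exact he _ ⟨bh, bt, h1, h2, rfl⟩
    rw [psiGen, psiGen, he, he', Real.sInf_empty]
    positivity
  · rw [← sub_le_iff_le_add]
    refine le_csInf hne ?_
    rintro r ⟨bh, bt, h1, h2, rfl⟩
    rw [sub_le_iff_le_add]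
    refine (psiGen_le hN2 Ω bh bt h1 h2).trans ?_
    have hsplit : (fun j => (∑ i, Ω j i * (bh i : ℝ)) + (bt j : ℝ)) =
        (fun j => (∑ i, Ω' j i * (bh i : ℝ)) + (bt j : ℝ)) +
          fun j => ∑ i, (Ω j i - Ω' j i) * (bh i : ℝ) := by
      ext j
      simp only [Pi.add_apply, sub_mul, Finset.sum_sub_distrib]
      ring
    rw [hsplit]
    refine (hN2.2.2 _ _).trans (add_le_add_right ((h₂ _).trans ?_) _)
    rw [mul_assoc]
    refine mul_le_mul_of_nonneg_left ?_ hC₂.le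
    have hb : ‖fun i => (bh i : ℝ)‖ ≤ t / c₁ := by
      rw [le_div_iff₀ hc₁, mul_comm]
      exact (h₁ _).trans h2
    refine (pi_norm_le_iff_of_nonneg (by positivity)).2 fun j => ?_
    calc ‖∑ i, (Ω j i - Ω' j i) * (bh i : ℝ)‖ ≤ ∑ i : Fin n, dist Ω Ω' * (t / c₁) := by
          refine norm_sum_le_of_le _ fun i _ => ?_
          rw [norm_mul]
          refine mul_le_mul ?_ ((norm_le_pi_norm (fun i => (bh i : ℝ)) i).trans hb)
            (norm_nonneg _) dist_nonneg
          rw [← dist_eq_norm]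
          exact (dist_le_pi_dist (Ω j) (Ω' j) i).trans (dist_le_pi_dist Ω Ω' j)
      _ = n * (t / c₁) * dist Ω Ω' := by
          rw [Finset.sum_const, Finset.card_univ, Fintype.card_fin, nsmul_eq_mul]
          ring

lemma psiGen_eq_zero_of_lt_one (Ω : Fin m → Fin n → ℝ) {t : ℝ} (ht : t < 1) :
    psiGen m n N1 N2 Ω t = 0 := by
  have he : { r : ℝ | ∃ (bh : Fin n → ℤ) (bt : Fin m → ℤ),
        1 ≤ N1 (fun i => (bh i : ℝ)) ∧ N1 (fun i => (bh i : ℝ)) ≤ t ∧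
        r = N2 (fun j => (∑ i, Ω j i * (bh i : ℝ)) + (bt j : ℝ)) } = ∅ := by
    rw [Set.eq_empty_iff_forall_notMem]
    rintro r ⟨bh, bt, h1, h2, -⟩
    linarith
  rw [psiGen, he, Real.sInf_empty]

lemma scaledPsi_lipOnTimes (hN1 : IsNorm N1) (hN2 : IsNorm N2) :
    LipOnTimes (scaledPsi m n N1 N2) := by
  obtain ⟨c₁, hc₁, h₁⟩ := hN1.exists_ge
  obtain ⟨C₂, hC₂, h₂⟩ := hN2.exists_le
  intro b
  have hone : ∀ w w' : Fin m → Fin n → ℝ, ∀ t ≤ b, scaledPsi m n N1 N2 w t ≤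
      scaledPsi m n N1 N2 w' t +
        ((max b 1) ^ ((n : ℝ) / m) * (C₂ * (n * (max b 1 / c₁))) + 1) * dist w w' := by
    intro w w' t ht
    rcases lt_or_ge t 1 with h1 | h1
    · rw [scaledPsi, scaledPsi, psiGen_eq_zero_of_lt_one _ h1, psiGen_eq_zero_of_lt_one _ h1]
      simp only [mul_zero, zero_add]
      positivity
    · have h0 : 0 ≤ t := by linarith
      have htb : t ≤ max b 1 := ht.trans (le_max_left _ _)
      have := mul_le_mul_of_nonneg_left (psiGen_le_add hN2 hc₁ hC₂ h₁ h₂ w w' h0)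
        (Real.rpow_nonneg h0 ((n : ℝ) / m))
      rw [scaledPsi, scaledPsi]
      refine this.trans ?_
      rw [mul_add, ← mul_assoc (t ^ _) (C₂ * _)]
      gcongr
      refine le_trans ?_ (le_add_of_nonneg_right zero_le_one)
      gcongr
  refine ⟨(max b 1) ^ ((n : ℝ) / m) * (C₂ * (n * (max b 1 / c₁))) + 1, ?_,
    fun w w' t ht => abs_sub_le_iff.2 ⟨?_, ?_⟩⟩
  · positivity
  · linarith [hone w w' t ht]
  · rw [dist_comm]
    linarith [hone w' w t ht]

end Psi

section Dirichlet

/-- Dirichlet's theorem for systems of linear forms, by the pigeonhole principle. -/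
lemma exists_approx_of_pigeonhole {M n : ℕ} (hM : 0 < M) (hn : 0 < n) (A : Fin M → Fin n → ℝ)
    {X : ℕ} (hX : 1 ≤ X) :
    ∃ b : Fin n → ℤ, b ≠ 0 ∧ (∀ i, |b i| ≤ X) ∧ ∃ p : Fin M → ℤ,
      ∀ j, |(∑ i, A j i * (b i : ℝ)) + p j| ≤ 2 * (X : ℝ) ^ (-((n : ℝ) / M)) := by
  have hX' : (1 : ℝ) ≤ X := by exact_mod_cast hX
  set y : ℝ := (X : ℝ) ^ ((n : ℝ) / M) with hy
  have hy1 : 1 ≤ y := Real.one_le_rpow hX' (by positivity)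
  set h : ℕ := ⌊y⌋₊ with hh
  have hh1 : 1 ≤ h := Nat.le_floor (by simpa using hy1)
  have hh0 : (0 : ℝ) < h := by exact_mod_cast hh1
  have hhy : (h : ℝ) ≤ y := Nat.floor_le (by linarith)
  have hyh : y ≤ 2 * h := by
    have h1 := Nat.lt_floor_add_one y
    have h2 : (1 : ℝ) ≤ h := by exact_mod_cast hh1
    rw [← hh] at h1
    linarith
  let v : (Fin n → Fin (X + 1)) → Fin M → ℝ := fun a j => ∑ i, A j i * ((a i : ℕ) : ℝ)
  let φ : (Fin n → Fin (X + 1)) → Fin M → Fin h := fun a j =>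
    ⟨⌊(h : ℝ) * Int.fract (v a j)⌋₊, (Nat.floor_lt (by have := Int.fract_nonneg (v a j); positivity)).2
      (by nlinarith [Int.fract_lt_one (v a j)])⟩
  have hcard : Fintype.card (Fin M → Fin h) < Fintype.card (Fin n → Fin (X + 1)) := by
    simp only [Fintype.card_fun, Fintype.card_fin]
    have h1 : (h : ℝ) ^ M ≤ (X : ℝ) ^ n := by
      calc (h : ℝ) ^ M ≤ y ^ M := by gcongr
        _ = (X : ℝ) ^ n := by
          rw [hy, ← Real.rpow_natCast, ← Real.rpow_mul (by positivity), div_mul_cancel₀,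
            Real.rpow_natCast]
          positivity
    have h2 : h ^ M ≤ X ^ n := by exact_mod_cast h1
    exact h2.trans_lt (Nat.pow_lt_pow_left (Nat.lt_succ_self X) hn.ne')
  obtain ⟨a, a', hne, heq⟩ := Fintype.exists_ne_map_eq_of_card_lt φ hcard
  refine ⟨fun i => ((a i : ℕ) : ℤ) - ((a' i : ℕ) : ℤ), ?_, fun i => ?_,
    fun j => ⌊v a' j⌋ - ⌊v a j⌋, fun j => ?_⟩
  · intro h0
    apply hne
    ext i
    have := congrFun h0 i
    simp only [Pi.zero_apply] at this
    omega
  · have h1 := (a i).is_lt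
    have h2 := (a' i).is_lt
    change |((a i : ℕ) : ℤ) - ((a' i : ℕ) : ℤ)| ≤ X
    rw [abs_le]
    constructor <;> omega
  · have hval : (∑ i, A j i * ((((a i : ℕ) : ℤ) - ((a' i : ℕ) : ℤ) : ℤ) : ℝ)) +
        ((⌊v a' j⌋ - ⌊v a j⌋ : ℤ) : ℝ) = Int.fract (v a j) - Int.fract (v a' j) := by
      simp only [Int.fract, v]
      push_cast
      simp only [mul_sub, Finset.sum_sub_distrib]
      ring
    rw [hval]
    have hfl : ⌊(h : ℝ) * Int.fract (v a j)⌋₊ = ⌊(h : ℝ) * Int.fract (v a' j)⌋₊ :=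
      congrArg Fin.val (congrFun heq j)
    have hp1 : 0 ≤ (h : ℝ) * Int.fract (v a j) := mul_nonneg hh0.le (Int.fract_nonneg _)
    have hp2 : 0 ≤ (h : ℝ) * Int.fract (v a' j) := mul_nonneg hh0.le (Int.fract_nonneg _)
    have h1 := Nat.floor_le hp1
    have h2 := Nat.floor_le hp2
    have h3 := Nat.lt_floor_add_one ((h : ℝ) * Int.fract (v a j))
    have h4 := Nat.lt_floor_add_one ((h : ℝ) * Int.fract (v a' j))
    rw [hfl] at h1 h3
    have h5 : (h : ℝ) * |Int.fract (v a j) - Int.fract (v a' j)| ≤ 1 := by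
      rw [← abs_of_pos hh0, ← abs_mul, mul_sub, abs_le]
      constructor <;> linarith
    rw [Real.rpow_neg (by positivity), ← hy, ← div_eq_mul_inv, le_div_iff₀ (by linarith)]
    nlinarith [abs_nonneg (Int.fract (v a j) - Int.fract (v a' j))]

variable {m n : ℕ} {N1 : (Fin n → ℝ) → ℝ} {N2 : (Fin m → ℝ) → ℝ}

/-- If `q` clears the denominators of all rows of `Ω` outside the range of `R`, only the rows
in the range of `R` matter for approximation by multiples of `q`. -/
lemma scaledPsi_le_of_rows (hn : 0 < n) {M : ℕ} (hM : 0 < M)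
    (hN2 : IsNorm N2) {c₁ C₁ C₂ : ℝ} (hC₁ : 0 < C₁) (hC₂ : 0 < C₂)
    (h₁ : ∀ x, c₁ * ‖x‖ ≤ N1 x) (h₁' : ∀ x, N1 x ≤ C₁ * ‖x‖) (h₂ : ∀ x, N2 x ≤ C₂ * ‖x‖)
    (R : Fin M → Fin m)
    {q : ℕ} (hq : 0 < q) (hqc : 1 ≤ q * c₁) (Ω : Fin m → Fin n → ℝ)
    (hΩ : ∀ j ∉ Set.range R, ∀ i, ∃ z : ℤ, (q : ℝ) * Ω j i = z) {t : ℝ} (ht : q * C₁ ≤ t) :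
    scaledPsi m n N1 N2 Ω t ≤
      2 * C₂ * (2 * (q * C₁)) ^ ((n : ℝ) / M) * t ^ ((n : ℝ) / m - (n : ℝ) / M) := by
  have hq0 : (0 : ℝ) < q := by exact_mod_cast hq
  have hqC : 0 < q * C₁ := by positivity
  have ht0 : 0 < t := by linarith
  set X : ℕ := ⌊t / (q * C₁)⌋₊ with hXdef
  have hX : 1 ≤ X := Nat.le_floor (by rw [le_div_iff₀ hqC]; simpa using ht)
  have hX' : (1 : ℝ) ≤ X := by exact_mod_cast hX
  have hXle : (X : ℝ) * (q * C₁) ≤ t := by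
    rw [← le_div_iff₀ hqC]
    exact Nat.floor_le (by positivity)
  have hXge : t / (2 * (q * C₁)) ≤ X := by
    have h1 : t / (q * C₁) < X + 1 := Nat.lt_floor_add_one _
    rw [div_lt_iff₀ hqC] at h1
    rw [div_le_iff₀ (by positivity)]
    nlinarith
  obtain ⟨b, hb0, hb, p, hp⟩ := exists_approx_of_pigeonhole hM hn
    (fun j i => (q : ℝ) * Ω (R j) i) hX
  choose! z hz using hΩ
  classical
  let bt : Fin m → ℤ := fun j => if h : j ∈ Set.range R then p h.choose else -∑ i, z j i * b i
  have hnorm : ‖fun i => (((q : ℤ) * b i : ℤ) : ℝ)‖ = q * ‖fun i => (b i : ℝ)‖ := by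
    have : (fun i => (((q : ℤ) * b i : ℤ) : ℝ)) = (q : ℝ) • fun i => (b i : ℝ) := by
      ext i; simp
    rw [this, norm_smul, Real.norm_of_nonneg hq0.le]
  have hbX : ‖fun i => (b i : ℝ)‖ ≤ X := by
    refine (pi_norm_le_iff_of_nonneg (by positivity)).2 fun i => ?_
    rw [Real.norm_eq_abs]
    exact_mod_cast hb i
  have hb1 : 1 ≤ ‖fun i => (b i : ℝ)‖ := one_le_norm_intCast hb0
  have hle := psiGen_le (N1 := N1) (t := t) hN2 Ω (fun i => (q : ℤ) * b i) bt
    (by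
      refine le_trans ?_ (h₁ _)
      rw [hnorm]
      nlinarith)
    (by
      refine (h₁' _).trans ?_
      rw [hnorm]
      calc C₁ * (q * ‖fun i => (b i : ℝ)‖) ≤ C₁ * (q * X) := by gcongr
        _ ≤ t := by linarith)
  have hsmall : ‖fun j => (∑ i, Ω j i * (((q : ℤ) * b i : ℤ) : ℝ)) + (bt j : ℝ)‖ ≤
      2 * (X : ℝ) ^ (-((n : ℝ) / M)) := by
    refine (pi_norm_le_iff_of_nonneg (by positivity)).2 fun j => ?_
    by_cases hj : j ∈ Set.range R
    · have h1 := hp hj.choose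
      have h2 : R hj.choose = j := hj.choose_spec
      simp only [h2] at h1
      rw [Real.norm_eq_abs]
      simp only [bt, dif_pos hj]
      convert h1 using 4 with i
      push_cast
      ring
    · simp only [bt, dif_neg hj]
      have : ∑ i, Ω j i * (((q : ℤ) * b i : ℤ) : ℝ) = ∑ i, (z j i : ℝ) * b i := by
        refine Finset.sum_congr rfl fun i _ => ?_
        rw [← hz j hj i]
        push_cast
        ring
      rw [this]
      push_cast
      rw [add_neg_cancel, norm_zero]
      positivity
  have hXpow : (X : ℝ) ^ (-((n : ℝ) / M)) ≤ (t / (2 * (q * C₁))) ^ (-((n : ℝ) / M)) :=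
    Real.rpow_le_rpow_of_nonpos (by positivity) hXge (neg_nonpos.2 (by positivity))
  rw [scaledPsi]
  calc t ^ ((n : ℝ) / m) * psiGen m n N1 N2 Ω t
      ≤ t ^ ((n : ℝ) / m) * (C₂ * (2 * (t / (2 * (q * C₁))) ^ (-((n : ℝ) / M)))) := by
        gcongr
        refine hle.trans ((h₂ _).trans ?_)
        gcongr
        exact hsmall.trans (by gcongr)
    _ = _ := by
        rw [Real.div_rpow ht0.le (by positivity), Real.rpow_neg (by positivity : 0 ≤ 2 * (q * C₁)),
          div_inv_eq_mul, Real.rpow_sub ht0, Real.rpow_neg ht0.le]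
        ring

lemma scaledPsi_bounded (hm : 0 < m) (hn : 0 < n) (hN1 : IsNorm N1) (hN2 : IsNorm N2) :
    ∃ C T : ℝ, ∀ Ω : Fin m → Fin n → ℝ, ∀ t ≥ T, scaledPsi m n N1 N2 Ω t ≤ C := by
  obtain ⟨c₁, hc₁, h₁⟩ := hN1.exists_ge
  obtain ⟨C₁, hC₁, h₁'⟩ := hN1.exists_le
  obtain ⟨C₂, hC₂, h₂⟩ := hN2.exists_le
  obtain ⟨q, hq⟩ := exists_nat_gt (1 / c₁)
  have hq0 : (0 : ℝ) < q := (by positivity : 0 < 1 / c₁).trans hq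
  refine ⟨2 * C₂ * (2 * (q * C₁)) ^ ((n : ℝ) / m), q * C₁, fun Ω t ht => ?_⟩
  have := scaledPsi_le_of_rows hn hm hN2 hC₁ hC₂ h₁ h₁' h₂ id
    (by exact_mod_cast hq0) (by rw [div_lt_iff₀ hc₁] at hq; exact hq.le) Ω (by simp) ht
  simpa using this

end Dirichlet

section Measure

/-- The volume of the part of a cube on which a given integer linear form is `r`-close to `ℤ`. -/
lemma volume_closedBall_inter_slab_le {n : ℕ} (ω₀ : Fin n → ℝ) {ρ r : ℝ} (hρ : 0 < ρ) (hr : 0 ≤ r)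
    (hr' : r ≤ 1 / 2) {b : Fin n → ℤ} (hb : b ≠ 0) :
    volume (Metric.closedBall ω₀ ρ ∩ {ω | ∃ p : ℤ, |(∑ k, ω k * (b k : ℝ)) + p| ≤ r}) ≤
      volume (Metric.closedBall ω₀ ρ) *
        ENNReal.ofReal (2 * r * (n + 1 / (ρ * ‖fun i => (b i : ℝ)‖))) := by
  obtain ⟨i₀, hi₀⟩ := Function.ne_iff.1 hb
  have : Nonempty (Fin n) := ⟨i₀⟩
  obtain ⟨i, hi⟩ := Finite.exists_max fun i => |(b i : ℝ)|
  set β : ℝ := |(b i : ℝ)| with hβ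
  have hnorm : ‖fun i => (b i : ℝ)‖ = β := by
    apply le_antisymm
    · exact (pi_norm_le_iff_of_nonneg (abs_nonneg _)).2 fun k => hi k
    · exact norm_le_pi_norm (fun i => (b i : ℝ)) i
  have hβ1 : 1 ≤ β := hnorm ▸ one_le_norm_intCast hb
  rw [hnorm]
  set s : ℝ := ∑ k, ω₀ k * (b k : ℝ) with hs
  set A : ℝ := -s - ρ * n * β - r
  set B : ℝ := -s + ρ * n * β + r
  let Ji : Set ℝ := ⋃ p ∈ Finset.Icc ⌈A⌉ ⌊B⌋, Metric.closedBall (-(p : ℝ)) r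
  let J : Fin n → Set ℝ := Function.update (fun k => Metric.closedBall (ω₀ k) ρ) i Ji
  let Mx : Matrix (Fin n) (Fin n) ℝ := (1 : Matrix (Fin n) (Fin n) ℝ).updateRow i fun k => b k
  have hdet : LinearMap.det (Matrix.toLin' Mx) = b i := by
    rw [LinearMap.det_toLin', ← Matrix.cramer_transpose_apply]
    simp
  have hbi : (b i : ℝ) ≠ 0 := by
    intro h
    rw [hβ, h, abs_zero] at hβ1
    linarith
  have hsub : Metric.closedBall ω₀ ρ ∩ {ω | ∃ p : ℤ, |(∑ k, ω k * (b k : ℝ)) + p| ≤ r} ⊆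
      Matrix.toLin' Mx ⁻¹' Set.pi Set.univ J := by
    rintro ω ⟨hω, p, hp⟩
    have hωk : ∀ k, |ω k - ω₀ k| ≤ ρ := fun k => by
      rw [← Real.dist_eq]
      exact (dist_le_pi_dist ω ω₀ k).trans hω
    rw [Set.mem_preimage, Set.mem_univ_pi]
    intro k
    rw [Matrix.toLin'_apply]
    by_cases hk : k = i
    · subst hk
      have hval : Matrix.mulVec Mx ω k = ∑ l, ω l * (b l : ℝ) := by
        simp [Mx, Matrix.mulVec, dotProduct, mul_comm]
      have hdiff : |(∑ l, ω l * (b l : ℝ)) - s| ≤ ρ * n * β := by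
        rw [hs, ← Finset.sum_sub_distrib]
        calc |∑ l, (ω l * (b l : ℝ) - ω₀ l * b l)| ≤ ∑ l : Fin n, ρ * β := by
              refine (Finset.abs_sum_le_sum_abs _ _).trans (Finset.sum_le_sum fun l _ => ?_)
              rw [← sub_mul, abs_mul]
              exact mul_le_mul (hωk l) (hi l) (abs_nonneg _) hρ.le
          _ = ρ * n * β := by
              rw [Finset.sum_const, Finset.card_univ, Fintype.card_fin, nsmul_eq_mul]
              ring
      rw [hval]
      simp only [J, Function.update_self, Ji, Set.mem_iUnion]
      have h1 := abs_le.1 hdiff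
      have h2 := abs_le.1 hp
      refine ⟨p, Finset.mem_Icc.2 ⟨Int.ceil_le.2 ?_, Int.le_floor.2 ?_⟩, ?_⟩
      · simp only [A]; linarith
      · simp only [B]; linarith
      · rw [Metric.mem_closedBall, Real.dist_eq, sub_neg_eq_add]
        exact hp
    · have hval : Matrix.mulVec Mx ω k = ω k := by
        simp [Mx, Matrix.mulVec, dotProduct, Matrix.updateRow_ne hk, Matrix.one_apply]
      rw [hval]
      simp only [J, Function.update_of_ne hk]
      rw [Metric.mem_closedBall, Real.dist_eq]
      exact hωk k
  have hJi : volume Ji ≤ ENNReal.ofReal ((2 * ρ * n * β + 2) * (2 * r)) := by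
    refine (measure_biUnion_finset_le _ _).trans ?_
    simp only [Real.volume_closedBall, Finset.sum_const, nsmul_eq_mul, Int.card_Icc]
    rw [← ENNReal.ofReal_natCast, ← ENNReal.ofReal_mul (by positivity)]
    refine ENNReal.ofReal_le_ofReal (mul_le_mul_of_nonneg_right ?_ (by positivity))
    have hfl := Int.floor_le B
    have hce := Int.le_ceil A
    have hAB : B - A = 2 * ρ * n * β + 2 * r := by simp only [A, B]; ring
    rcases le_total 0 (⌊B⌋ + 1 - ⌈A⌉) with h | h
    · have : (((⌊B⌋ + 1 - ⌈A⌉).toNat : ℤ) : ℝ) = ((⌊B⌋ + 1 - ⌈A⌉ : ℤ) : ℝ) := by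
        rw [Int.toNat_of_nonneg h]
      push_cast at this
      rw [this]
      linarith
    · rw [Int.toNat_of_nonpos h]
      simp only [Nat.cast_zero]
      positivity
  have hpi : volume (Set.pi Set.univ J) ≤
      ENNReal.ofReal ((2 * ρ * n * β + 2) * (2 * r)) * ENNReal.ofReal (2 * ρ) ^ (n - 1) := by
    rw [volume_pi_pi, ← Finset.mul_prod_erase _ _ (Finset.mem_univ i)]
    refine mul_le_mul' (by simpa [J] using hJi) (le_of_eq ?_)
    rw [Finset.prod_congr rfl (g := fun _ => ENNReal.ofReal (2 * ρ))]
    · simp [Finset.card_erase_of_mem]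
    · intro k hk
      simp [J, Function.update_of_ne (Finset.ne_of_mem_erase hk)]
  refine (measure_mono hsub).trans ?_
  rw [Measure.addHaar_preimage_linearMap _ (by rw [hdet]; exact hbi), hdet,
    Real.volume_pi_closedBall _ hρ.le, abs_inv, ← hβ, Fintype.card_fin]
  refine (mul_le_mul_right hpi _).trans (le_of_eq ?_)
  have hβ0 : 0 < β := by linarith
  rw [← ENNReal.ofReal_pow (by positivity), ← ENNReal.ofReal_mul (by positivity),
    ← ENNReal.ofReal_mul (by positivity), ← ENNReal.ofReal_mul (by positivity)]
  congr 1
  obtain ⟨l, rfl⟩ : ∃ l, n = l + 1 := ⟨n - 1, by have := i.pos; omega⟩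
  rw [Nat.add_sub_cancel, pow_succ]
  field_simp

/-- The integer points of the cube of radius `X`. -/
noncomputable def intBox (n X : ℕ) : Finset (Fin n → ℤ) := Fintype.piFinset fun _ => Finset.Icc (-(X : ℤ)) X

lemma mem_intBox {n X : ℕ} {b : Fin n → ℤ} {x : ℝ} (hx : ⌊x⌋₊ ≤ X)
    (hb : ‖fun i => (b i : ℝ)‖ ≤ x) : b ∈ intBox n X := by
  rw [intBox, Fintype.mem_piFinset]
  intro i
  have h1 : ((b i).natAbs : ℝ) ≤ x := by
    rw [Nat.cast_natAbs, Int.cast_abs]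
    exact (norm_le_pi_norm (fun i => (b i : ℝ)) i).trans hb
  have h2 : (b i).natAbs ≤ X := (Nat.le_floor h1).trans hx
  rw [Finset.mem_Icc]
  omega

lemma card_intBox (n X : ℕ) : (intBox n X).card = (2 * X + 1) ^ n := by
  have : ((X : ℤ) + 1 + (X : ℤ)).toNat = 2 * X + 1 := by omega
  simp [intBox, this]

lemma sum_intBox_le {n m : ℕ} {ρ : ℝ} (hρ : 0 < ρ) {X : ℕ} (hX : 1 ≤ X) :
    ∑ b ∈ (intBox n X).filter (· ≠ 0), (n + 1 / (ρ * ‖fun i => (b i : ℝ)‖)) ^ m ≤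
      (3 * X : ℝ) ^ n * (n + 1) ^ m + (2 * ⌊1 / ρ⌋₊ + 1) ^ n * (n + 1 / ρ) ^ m := by
  classical
  have hterm : ∀ b ∈ (intBox n X).filter (· ≠ 0), (n + 1 / (ρ * ‖fun i => (b i : ℝ)‖)) ^ m ≤
      (n + 1 : ℝ) ^ m + if b ∈ intBox n ⌊1 / ρ⌋₊ then (n + 1 / ρ) ^ m else 0 := by
    intro b hb
    have hb1 := one_le_norm_intCast (Finset.mem_filter.1 hb).2
    set β := ‖fun i => (b i : ℝ)‖
    rcases le_total β (1 / ρ) with h | h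
    · rw [if_pos (mem_intBox le_rfl h)]
      refine le_trans ?_ (le_add_of_nonneg_left (by positivity))
      have : ρ ≤ ρ * β := le_mul_of_one_le_right hρ.le hb1
      gcongr
    · refine le_trans ?_ (le_add_of_nonneg_right (by split_ifs <;> positivity))
      have : 1 / (ρ * β) ≤ 1 := by
        rw [div_le_iff₀ hρ] at h
        rw [div_le_one (by positivity)]
        linarith
      gcongr
  refine (Finset.sum_le_sum hterm).trans ?_
  rw [Finset.sum_add_distrib, Finset.sum_ite_mem, Finset.sum_const, Finset.sum_const, nsmul_eq_mul,
    nsmul_eq_mul]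
  have hX' : (1 : ℝ) ≤ X := by exact_mod_cast hX
  have h1 : (((intBox n X).filter (· ≠ 0)).card : ℝ) ≤ (3 * X : ℝ) ^ n := by
    have : ((intBox n X).filter (· ≠ 0)).card ≤ (2 * X + 1) ^ n :=
      (Finset.card_filter_le _ _).trans (card_intBox n X).le
    calc (((intBox n X).filter (· ≠ 0)).card : ℝ) ≤ ((2 * X + 1) ^ n : ℕ) := by exact_mod_cast this
      _ ≤ (3 * X : ℝ) ^ n := by
        push_cast
        gcongr
        linarith
  have h2 : ((((intBox n X).filter (· ≠ 0)) ∩ intBox n ⌊1 / ρ⌋₊).card : ℝ) ≤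
      (2 * ⌊1 / ρ⌋₊ + 1) ^ n := by
    have := (Finset.card_le_card (Finset.inter_subset_right
      (s₁ := (intBox n X).filter (· ≠ 0)) (s₂ := intBox n ⌊1 / ρ⌋₊))).trans (card_intBox n _).le
    exact_mod_cast this
  gcongr

variable {m n : ℕ} {N1 : (Fin n → ℝ) → ℝ} {N2 : (Fin m → ℝ) → ℝ}

lemma exists_bound_psi_set_nonempty (hn : 0 < n) (hN1 : IsNorm N1) :
    ∃ T : ℝ, ∀ t ≥ T, ∀ Ω : Fin m → Fin n → ℝ,
      { r : ℝ | ∃ (bh : Fin n → ℤ) (bt : Fin m → ℤ),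
        1 ≤ N1 (fun i => (bh i : ℝ)) ∧ N1 (fun i => (bh i : ℝ)) ≤ t ∧
        r = N2 (fun j => (∑ i, Ω j i * (bh i : ℝ)) + (bt j : ℝ)) }.Nonempty := by
  obtain ⟨c₁, hc₁, h₁⟩ := hN1.exists_ge
  obtain ⟨q, hq⟩ := exists_nat_gt (1 / c₁)
  have hq0 : (0 : ℝ) < q := (by positivity : 0 < 1 / c₁).trans hq
  refine ⟨N1 (fun _ => ((q : ℤ) : ℝ)), fun t ht Ω => ⟨_, fun _ => q, 0, ?_, ht, rfl⟩⟩
  refine le_trans ?_ (h₁ _)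
  have : ((q : ℤ) : ℝ) ≤ ‖fun _ : Fin n => ((q : ℤ) : ℝ)‖ :=
    (le_abs_self _).trans (norm_le_pi_norm (fun _ : Fin n => ((q : ℤ) : ℝ)) ⟨0, hn⟩)
  rw [div_lt_iff₀ hc₁] at hq
  push_cast at this ⊢
  nlinarith

/-- In every cube, at most half of the matrices have `t^{n/m} ψ_Ω(t) ≤ c` once `t` is large. -/
lemma exists_volume_le_half (hm : 0 < m) (hn : 0 < n) (hN1 : IsNorm N1) (hN2 : IsNorm N2) :
    ∃ c > 0, ∀ (Ω₀ : Fin m → Fin n → ℝ) (ρ : ℝ), 0 < ρ → ∀ᶠ t : ℝ in atTop,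
      volume ({Ω | scaledPsi m n N1 N2 Ω t ≤ c} ∩ Metric.closedBall Ω₀ ρ) ≤
        ENNReal.ofReal (1 / 2) * volume (Metric.closedBall Ω₀ ρ) := by
  obtain ⟨c₁, hc₁, h₁⟩ := hN1.exists_ge
  obtain ⟨c₂, hc₂, h₂⟩ := hN2.exists_ge
  obtain ⟨T, hT⟩ := exists_bound_psi_set_nonempty (m := m) (N2 := N2) hn hN1
  set A : ℝ := (4 / c₂) ^ m * (3 / c₁) ^ n * (n + 1) ^ m with hA
  have hA0 : 0 < A := by positivity
  set c : ℝ := min 1 (1 / (4 * A)) with hc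
  have hc0 : 0 < c := lt_min one_pos (by positivity)
  have hcm : c ^ m * A ≤ 1 / 4 := by
    have h1 : c ^ m ≤ c := by
      simpa using pow_le_pow_of_le_one hc0.le (min_le_left _ _) (show 1 ≤ m from hm)
    have h2 : c ≤ 1 / (4 * A) := min_le_right _ _
    rw [le_div_iff₀ (by positivity)] at h2
    nlinarith
  refine ⟨c, hc0, fun Ω₀ ρ hρ => ?_⟩
  set r : ℝ → ℝ := fun t => 2 * c / c₂ * t ^ (-((n : ℝ) / m)) with hrdef
  have hr0 : Tendsto r atTop (nhds 0) := by
    have := (tendsto_rpow_neg_atTop (show (0 : ℝ) < (n : ℝ) / m by positivity)).const_mul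
      (2 * c / c₂)
    simpa using this
  set K : ℝ := (2 * ⌊1 / ρ⌋₊ + 1) ^ n * (n + 1 / ρ) ^ m with hK
  have hKt : Tendsto (fun t => (2 * r t) ^ m * K) atTop (nhds 0) := by
    have := ((hr0.const_mul 2).pow m).mul_const K
    simpa [hm.ne'] using this
  filter_upwards [hr0.eventually_le_const (show (0 : ℝ) < 1 / 2 by norm_num),
    hKt.eventually_le_const (show (0 : ℝ) < 1 / 4 by norm_num), eventually_ge_atTop T,
    eventually_ge_atTop c₁] with t hrt hKt htT htc
  have ht0 : 0 < t := by linarith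
  have hrt0 : 0 ≤ r t := by positivity
  set X : ℕ := ⌊t / c₁⌋₊ with hX
  have hX1 : 1 ≤ X := Nat.le_floor (by rw [le_div_iff₀ hc₁]; simpa using htc)
  have hXle : (X : ℝ) ≤ t / c₁ := Nat.floor_le (by positivity)
  have hrm : (2 * r t) ^ m = (4 * c / c₂) ^ m / t ^ n := by
    have h1 : (t ^ (-((n : ℝ) / m))) ^ m = (t ^ n)⁻¹ := by
      rw [← Real.rpow_natCast, ← Real.rpow_mul ht0.le, neg_mul, div_mul_cancel₀ _ (by positivity),
        Real.rpow_neg ht0.le, Real.rpow_natCast]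
    rw [hrdef]
    simp only
    rw [← mul_assoc, mul_pow, h1, div_eq_mul_inv]
    congr 2
    ring
  have hsub : {Ω | scaledPsi m n N1 N2 Ω t ≤ c} ∩ Metric.closedBall Ω₀ ρ ⊆
      ⋃ b ∈ (intBox n X).filter (· ≠ 0), Set.pi Set.univ fun j =>
        Metric.closedBall (Ω₀ j) ρ ∩ {ω | ∃ p : ℤ, |(∑ k, ω k * (b k : ℝ)) + p| ≤ r t} := by
    rintro Ω ⟨hΩ, hball⟩
    have hpsi : psiGen m n N1 N2 Ω t < 2 * c * t ^ (-((n : ℝ) / m)) := by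
      have hpos : 0 < t ^ ((n : ℝ) / m) := Real.rpow_pos_of_pos ht0 _
      rw [Real.rpow_neg ht0.le, ← div_eq_mul_inv, lt_div_iff₀ hpos]
      have : t ^ ((n : ℝ) / m) * psiGen m n N1 N2 Ω t ≤ c := hΩ
      linarith
    obtain ⟨_, ⟨bh, bt, hb1, hbt, rfl⟩, hlt⟩ := exists_lt_of_csInf_lt (hT t htT Ω) hpsi
    have hbne : bh ≠ 0 := by
      rintro rfl
      have : N1 (fun i => (((0 : Fin n → ℤ) i : ℤ) : ℝ)) = 0 := (hN1.1 _).2 (by ext; simp)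
      linarith
    have hbX : bh ∈ intBox n X := by
      refine mem_intBox le_rfl (x := t / c₁) ?_
      rw [le_div_iff₀ hc₁, mul_comm]
      exact (h₁ _).trans hbt
    simp only [Set.mem_iUnion]
    refine ⟨bh, Finset.mem_filter.2 ⟨hbX, hbne⟩, fun j _ => ⟨?_, bt j, ?_⟩⟩
    · exact (dist_le_pi_dist Ω Ω₀ j).trans hball
    · have h3 := (mul_le_mul_of_nonneg_left (norm_le_pi_norm
        (fun j => (∑ i, Ω j i * (bh i : ℝ)) + (bt j : ℝ)) j) hc₂.le).trans ((h₂ _).trans hlt.le)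
      rw [Real.norm_eq_abs] at h3
      rw [hrdef]
      simp only
      rw [div_mul_eq_mul_div, le_div_iff₀ hc₂]
      linarith
  have hvol : volume (Metric.closedBall Ω₀ ρ) = ∏ j, volume (Metric.closedBall (Ω₀ j) ρ) := by
    rw [closedBall_pi _ hρ.le, volume_pi_pi]
  refine (measure_mono hsub).trans ((measure_biUnion_finset_le _ _).trans ?_)
  calc ∑ b ∈ (intBox n X).filter (· ≠ 0), volume (Set.pi Set.univ fun j =>
        Metric.closedBall (Ω₀ j) ρ ∩ {ω | ∃ p : ℤ, |(∑ k, ω k * (b k : ℝ)) + p| ≤ r t})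
      ≤ ∑ b ∈ (intBox n X).filter (· ≠ 0), ENNReal.ofReal
          ((2 * r t * (n + 1 / (ρ * ‖fun i => (b i : ℝ)‖))) ^ m) *
            volume (Metric.closedBall Ω₀ ρ) := by
        refine Finset.sum_le_sum fun b hb => ?_
        rw [volume_pi_pi]
        refine (Finset.prod_le_prod' fun j _ => volume_closedBall_inter_slab_le (Ω₀ j) hρ hrt0 hrt
          (Finset.mem_filter.1 hb).2).trans (le_of_eq ?_)
        rw [Finset.prod_mul_distrib, ← hvol, Finset.prod_const, Finset.card_univ, Fintype.card_fin,
          ENNReal.ofReal_pow (by positivity), mul_comm]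
    _ = ENNReal.ofReal (∑ b ∈ (intBox n X).filter (· ≠ 0),
          (2 * r t * (n + 1 / (ρ * ‖fun i => (b i : ℝ)‖))) ^ m) *
            volume (Metric.closedBall Ω₀ ρ) := by
        rw [← Finset.sum_mul, ENNReal.ofReal_sum_of_nonneg fun b _ => by positivity]
    _ ≤ _ := by
        gcongr
        simp only [mul_pow _ (_ + _)]
        rw [← Finset.mul_sum]
        have h5 := mul_le_mul_of_nonneg_left (sum_intBox_le (n := n) (m := m) hρ hX1)
          (show 0 ≤ (2 * r t) ^ m by positivity)
        rw [mul_add] at h5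
        have h6 : (2 * r t) ^ m * ((3 * X : ℝ) ^ n * (n + 1) ^ m) ≤ c ^ m * A := by
          calc (2 * r t) ^ m * ((3 * X : ℝ) ^ n * (n + 1) ^ m)
              ≤ (2 * r t) ^ m * ((3 * (t / c₁)) ^ n * (n + 1) ^ m) := by gcongr
            _ = c ^ m * A := by
              rw [hrm, hA]
              simp only [div_pow, mul_pow]
              field_simp
        rw [← hK] at h5
        linarith

/-- Almost every matrix has `t^{n/m} ψ_Ω(t) > c` for arbitrarily large `t`. -/
theorem exists_ae_frequently_lt (hm : 0 < m) (hn : 0 < n) (hN1 : IsNorm N1) (hN2 : IsNorm N2) :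
    ∃ c > 0, ∀ᵐ Ω : Fin m → Fin n → ℝ, ∀ N : ℝ, ∃ t ≥ N, c < scaledPsi m n N1 N2 Ω t := by
  obtain ⟨c, hc, h⟩ := exists_volume_le_half hm hn hN1 hN2
  refine ⟨c, hc, ?_⟩
  suffices hN : ∀ N : ℕ, ∀ᵐ Ω : Fin m → Fin n → ℝ, ∃ t ≥ (N : ℝ), c < scaledPsi m n N1 N2 Ω t by
    filter_upwards [ae_all_iff.2 hN] with Ω hΩ N
    obtain ⟨k, hk⟩ := exists_nat_gt N
    obtain ⟨t, ht, hlt⟩ := hΩ k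
    exact ⟨t, hk.le.trans ht, hlt⟩
  intro N
  set S : Set (Fin m → Fin n → ℝ) := {Ω | ¬ ∃ t ≥ (N : ℝ), c < scaledPsi m n N1 N2 Ω t} with hS
  change volume S = 0
  have hhalf : ∀ (Ω₀ : Fin m → Fin n → ℝ) (ρ : ℝ), 0 < ρ →
      volume (S ∩ Metric.closedBall Ω₀ ρ) / volume (Metric.closedBall Ω₀ ρ) ≤
        ENNReal.ofReal (1 / 2) := by
    intro Ω₀ ρ hρ
    obtain ⟨t, htle, htN⟩ := ((h Ω₀ ρ hρ).and (eventually_ge_atTop (N : ℝ))).exists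
    refine ENNReal.div_le_of_le_mul ((measure_mono (Set.inter_subset_inter_left _ ?_)).trans htle)
    intro Ω hΩ
    simp only [hS, Set.mem_ofPred_eq, not_exists, not_and, not_lt] at hΩ
    exact hΩ t htN
  have hden := IsUnifLocDoublingMeasure.ae_tendsto_measure_inter_div
    (volume : Measure (Fin m → Fin n → ℝ)) S 1
  rw [← Measure.restrict_eq_zero, ← ae_eq_bot, ← eventually_false_iff_eq_bot]
  filter_upwards [hden] with Ω hΩ
  have hδ : Tendsto (fun k : ℕ => 1 / ((k : ℝ) + 1)) atTop (nhdsWithin 0 (Set.Ioi 0)) :=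
    tendsto_nhdsWithin_iff.2 ⟨tendsto_one_div_add_atTop_nhds_zero_nat,
      Eventually.of_forall fun k => by simp only [Set.mem_Ioi]; positivity⟩
  have hlim := hΩ (fun _ => Ω) (fun k : ℕ => 1 / ((k : ℝ) + 1)) hδ
    (Eventually.of_forall fun k => Metric.mem_closedBall_self (by positivity))
  have hle := le_of_tendsto hlim (Eventually.of_forall fun k => hhalf Ω _ (by positivity))
  rw [← ENNReal.ofReal_one, ENNReal.ofReal_le_ofReal_iff (by norm_num)] at hle
  norm_num at hle

end Measure

section Relations

variable {m n : ℕ}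

/-- The rational affine form with coefficients `q`, evaluated at the entries of a matrix. -/
def ratForm (q : Option (Fin m × Fin n) → ℚ) (Ω : Fin m → Fin n → ℝ) : ℝ :=
  q none + ∑ p, (q (some p) : ℝ) * Ω p.1 p.2

/-- The linear part of `ratForm q`. -/
noncomputable def ratFormLinear (q : Option (Fin m × Fin n) → ℚ) :
    (Fin m → Fin n → ℝ) →L[ℝ] ℝ :=
  LinearMap.toContinuousLinearMap
    { toFun := fun Ω => ∑ p, (q (some p) : ℝ) * Ω p.1 p.2
      map_add' := fun x y => by simp [mul_add, Finset.sum_add_distrib]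
      map_smul' := fun c x => by
        simp only [Pi.smul_apply, smul_eq_mul, RingHom.id_apply, Finset.mul_sum]
        exact Finset.sum_congr rfl fun _ _ => by ring }

lemma ratForm_eq (q : Option (Fin m × Fin n) → ℚ) (Ω : Fin m → Fin n → ℝ) :
    ratForm q Ω = q none + ratFormLinear q Ω := rfl

lemma ratFormLinear_single (q : Option (Fin m × Fin n) → ℚ) (p : Fin m × Fin n) :
    ratFormLinear q (Pi.single p.1 (Pi.single p.2 1)) = q (some p) := by
  change ∑ p', (q (some p') : ℝ) * _ = _
  rw [Finset.sum_eq_single p]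
  · simp
  · intro p' _ hp'
    rcases eq_or_ne p'.1 p.1 with h | h
    · have : p'.2 ≠ p.2 := fun h2 => hp' (Prod.ext h h2)
      simp [h, this]
    · simp [h]
  · simp

lemma qIndepEntries_of_ratForm_ne_zero {Ω : Fin m → Fin n → ℝ}
    (h : ∀ q : {q : Option (Fin m × Fin n) → ℚ // q ≠ 0}, ratForm q.1 Ω ≠ 0) :
    QIndepEntries m n Ω := by
  rw [QIndepEntries, Fintype.linearIndependent_iff]
  intro q hq o
  by_contra ho
  refine h ⟨q, fun h0 => ho (congrFun h0 o)⟩ ?_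
  rw [← hq, Fintype.sum_option]
  simp [ratForm, Rat.smul_def]

lemma dense_add_apply_ne_zero {E : Type*} [NormedAddCommGroup E] [NormedSpace ℝ E]
    {l : E →L[ℝ] ℝ} (hl : l ≠ 0) (a : ℝ) : Dense {v | a + l v ≠ 0} := by
  refine ((dense_compl_singleton (-a)).preimage (l.isOpenMap_of_ne_zero hl)).mono ?_
  intro v hv h
  exact hv (by rw [Set.mem_singleton_iff]; linarith)

lemma ae_ratForm_ne_zero {q : Option (Fin m × Fin n) → ℚ} (hq : q ≠ 0) :
    ∀ᵐ Ω : Fin m → Fin n → ℝ, ratForm q Ω ≠ 0 := by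
  by_cases hl : ratFormLinear q = 0
  · refine Eventually.of_forall fun Ω h => hq ?_
    have h1 : ∀ p, q (some p) = 0 := fun p => by
      have := ratFormLinear_single q p
      rw [hl, zero_apply] at this
      exact_mod_cast this.symm
    have h2 : q none = 0 := by
      rw [ratForm_eq, hl] at h
      simpa using h
    funext o
    cases o with
    | none => exact h2
    | some p => exact h1 p
  · have hsurj : Function.Surjective (ratFormLinear q : (Fin m → Fin n → ℝ) →ₗ[ℝ] ℝ) :=
      LinearMap.surjective (fun h => hl (ContinuousLinearMap.coe_injective h))
    have := (ae_comp_linearMap_mem_iff _ volume volume hsurj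
      (measurableSet_singleton (-(q none : ℝ))).compl).2 (by
        rw [ae_iff]; simp)
    filter_upwards [this] with Ω hΩ h
    refine hΩ ?_
    rw [ratForm_eq] at h
    rw [Set.mem_singleton_iff, ContinuousLinearMap.coe_coe]
    linarith

lemma dense_slices_ratForm_ne_zero {U V X : Type*} [NormedAddCommGroup U] [NormedSpace ℝ U]
    [NormedAddCommGroup V] [NormedSpace ℝ V] [NormedAddCommGroup X] [NormedSpace ℝ X]
    (L : (X × (U × V)) →L[ℝ] (Fin m → Fin n → ℝ)) (x : X)
    (q : Option (Fin m × Fin n) → ℚ) (hq : ∃ w, ratForm q (L (x, w)) ≠ 0) :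
    (∀ u, Dense {v | (u, v) ∉ {w | ratForm q (L (x, w)) = 0}}) ∨
      ∀ v, Dense {u | (u, v) ∉ {w | ratForm q (L (x, w)) = 0}} := by
  set lU : U →L[ℝ] ℝ := ((ratFormLinear q).comp L).comp
    ((ContinuousLinearMap.inr ℝ X (U × V)).comp (ContinuousLinearMap.inl ℝ U V)) with hU
  set lV : V →L[ℝ] ℝ := ((ratFormLinear q).comp L).comp
    ((ContinuousLinearMap.inr ℝ X (U × V)).comp (ContinuousLinearMap.inr ℝ U V)) with hV
  have key : ∀ u v, ratForm q (L (x, (u, v))) = ratForm q (L (x, 0)) + lU u + lV v := by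
    intro u v
    have : (x, (u, v)) = (x, (0 : U × V)) + (0, (u, 0)) + (0, (0, v)) := by simp
    rw [this, map_add, map_add, ratForm_eq, ratForm_eq, map_add, map_add]
    simp [hU, hV, add_assoc]
  have hmem : ∀ u v, (u, v) ∉ {w | ratForm q (L (x, w)) = 0} ↔
      ratForm q (L (x, 0)) + lU u + lV v ≠ 0 := fun u v => by rw [← key]; rfl
  simp only [hmem]
  generalize ratForm q (L (x, 0)) = r at key hmem ⊢
  by_cases h1 : lV = 0
  · by_cases h2 : lU = 0
    · left
      obtain ⟨⟨u, v⟩, hw⟩ := hq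
      rw [key, h1, h2] at hw
      intro u'
      simp only [h1, h2]
      have hr : r ≠ 0 := by simpa using hw
      simp [hr]
    · right
      intro v
      simpa [add_right_comm] using dense_add_apply_ne_zero h2 (r + lV v)
  · left
    intro u
    exact dense_add_apply_ne_zero h1 _

end Relations

section Theta

variable {m n : ℕ} {N1 : (Fin n → ℝ) → ℝ} {N2 : (Fin m → ℝ) → ℝ}

lemma thetaGen_le (hN2 : IsNorm N2) {Ω : Fin m → Fin n → ℝ} {e T : ℝ}
    (h : ∀ t ≥ T, scaledPsi m n N1 N2 Ω t ≤ e) : ThetaGen m n N1 N2 Ω ≤ e := by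
  refine limsup_le_of_le ?_ ((eventually_ge_atTop T).mono h)
  exact isCoboundedUnder_le_of_eventually_le (x := 0) atTop
    ((eventually_ge_atTop 0).mono fun t ht => scaledPsi_nonneg hN2 Ω ht)

lemma le_thetaGen {Ω : Fin m → Fin n → ℝ} {e e' T : ℝ}
    (h : ∀ t ≥ T, scaledPsi m n N1 N2 Ω t ≤ e')
    (h' : ∀ N : ℝ, ∃ t ≥ N, e < scaledPsi m n N1 N2 Ω t) : e ≤ ThetaGen m n N1 N2 Ω := by
  refine le_limsup_of_frequently_le ?_ ?_
  · exact frequently_atTop.2 fun N => (h' N).imp fun t ht => ⟨ht.1, ht.2.le⟩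
  · exact isBoundedUnder_of_eventually_le ((eventually_ge_atTop T).mono h)

lemma not_thetaTildeGen_pos (hN2 : IsNorm N2) {Ω : Fin m → Fin n → ℝ}
    (h : ∀ δ > 0, ∀ N : ℝ, ∃ t ≥ N, scaledPsi m n N1 N2 Ω t < δ) :
    ¬ 0 < ThetaTildeGen m n N1 N2 Ω := by
  intro hpos
  have hb : IsBoundedUnder (· ≥ ·) atTop (scaledPsi m n N1 N2 Ω) :=
    isBoundedUnder_of_eventually_ge
      ((eventually_ge_atTop (0 : ℝ)).mono fun t ht => scaledPsi_nonneg hN2 Ω ht)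
  have := eventually_lt_of_lt_liminf (half_lt_self hpos) hb
  obtain ⟨N, hN⟩ := eventually_atTop.1 this
  obtain ⟨t, ht, hlt⟩ := h _ (half_pos hpos) N
  exact lt_asymm hlt (hN t ht)

lemma thetaGen_le_dirichletSup (hm : 0 < m) (hn : 0 < n) (hN1 : IsNorm N1) (hN2 : IsNorm N2)
    (Ω : Fin m → Fin n → ℝ) : ThetaGen m n N1 N2 Ω ≤ DirichletSup m n N1 N2 := by
  obtain ⟨C, T, h⟩ := scaledPsi_bounded hm hn hN1 hN2
  refine le_ciSup (f := fun Ω => ThetaGen m n N1 N2 Ω) ⟨C, ?_⟩ Ω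
  rintro _ ⟨Ω, rfl⟩
  exact thetaGen_le hN2 (h Ω)

end Theta

lemma LipOnTimes.comp {W W' : Type*} [PseudoMetricSpace W] [PseudoMetricSpace W']
    {g : W → ℝ → ℝ} (hg : LipOnTimes g) {f : W' → W} {C : NNReal} (hf : LipschitzWith C f) :
    LipOnTimes fun w => g (f w) := by
  intro b
  obtain ⟨K, hK, h⟩ := hg b
  refine ⟨K * (C + 1), by positivity, fun w w' t ht => (h _ _ t ht).trans ?_⟩
  rw [mul_assoc]
  gcongr
  exact (hf.dist_le_mul w w').trans (by gcongr; simp)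

/-- Lebesgue measure on matrices is a Haar measure. -/
lemma isAddHaarMeasure_volume_matrix (a b : ℕ) :
    (volume : Measure (Fin a → Fin b → ℝ)).IsAddHaarMeasure :=
  Measure.pi.isAddHaarMeasure fun _ => volume

section Fibers

variable {m n a b d : ℕ} {N1 : (Fin n → ℝ) → ℝ} {N2 : (Fin m → ℝ) → ℝ}

/-- If a linear parametrization of the matrices by `X × (U × V)` is such that in each fiber over `X`
there are densely many `u` and densely many `v` forcing excellent uniform approximation, then over
almost every `x` there are matrices with arbitrarily small positive `Θ`. -/
theorem exists_ae_forall_small_theta (hm : 0 < m) (hn : 0 < n) (hN1 : IsNorm N1) (hN2 : IsNorm N2)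
    (L : ((Fin a → Fin b → ℝ) × ((Fin d → ℝ) × (Fin d → ℝ))) ≃L[ℝ] (Fin m → Fin n → ℝ))
    (hP : ∀ x, Dense {u | VanishesUniformly (fun w t => scaledPsi m n N1 N2 (L (x, w)) t) u})
    (hQ : ∀ x, Dense {v | VanishesUniformly
      (fun w t => scaledPsi m n N1 N2 (L (x, Prod.swap w)) t) v}) :
    ∃ c > 0, ∀ᵐ x, ∀ e, 0 < e → e ≤ c → ∃ w,
      (0 < ThetaGen m n N1 N2 (L (x, w)) ∧ ThetaGen m n N1 N2 (L (x, w)) ≤ e ∧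
        ¬ 0 < ThetaTildeGen m n N1 N2 (L (x, w))) ∧ QIndepEntries m n (L (x, w)) := by
  obtain ⟨c, hc, hae⟩ := exists_ae_frequently_lt (N1 := N1) (N2 := N2) hm hn hN1 hN2
  refine ⟨c, hc, ?_⟩
  have hqi : ∀ᵐ Ω : Fin m → Fin n → ℝ,
      ∀ q : {q : Option (Fin m × Fin n) → ℚ // q ≠ 0}, ratForm q.1 Ω ≠ 0 :=
    ae_all_iff.2 fun q => ae_ratForm_ne_zero q.2
  have hL : Measure.QuasiMeasurePreserving L volume volume := by
    refine ⟨L.continuous.measurable, ?_⟩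
    have := isAddHaarMeasure_volume_matrix a b
    have := isAddHaarMeasure_volume_matrix m n
    have : (volume : Measure ((Fin d → ℝ) × (Fin d → ℝ))).IsAddHaarMeasure :=
      Measure.prod.instIsAddHaarMeasure volume volume
    have : (volume : Measure ((Fin a → Fin b → ℝ) ×
      ((Fin d → ℝ) × (Fin d → ℝ)))).IsAddHaarMeasure :=
      Measure.prod.instIsAddHaarMeasure volume volume
    have := L.isAddHaarMeasure_map volume
    exact Measure.absolutelyContinuous_isAddHaarMeasure _ _
  have h1 := Measure.ae_ae_of_ae_prod (hL.ae (hae.and hqi))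
  filter_upwards [h1] with x hx e he hec
  have hlip : LipOnTimes fun w t => scaledPsi m n N1 N2 (L (x, w)) t :=
    (scaledPsi_lipOnTimes hN1 hN2).comp (L.lipschitz.comp (LipschitzWith.prodMk_left x))
  obtain ⟨w, ⟨T, hT⟩, hw1, hw2, hw3⟩ := exists_oscillating hlip he hec (hP x) (hQ x)
    (Measure.dense_of_ae (hx.mono fun w hw => hw.1))
    (F := fun q : {q : Option (Fin m × Fin n) → ℚ // q ≠ 0} =>
      {w | ratForm q.1 (L (x, w)) = 0})
    (fun q => isClosed_eq (by simp only [ratForm_eq]; fun_prop) continuous_const)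
    (fun q => dense_slices_ratForm_ne_zero L.toContinuousLinearMap x q.1
      (hx.exists.imp fun w hw => hw.2 q))
  refine ⟨w, ⟨(half_pos he).trans_le (le_thetaGen hT hw1), thetaGen_le hN2 hT,
    not_thetaTildeGen_pos hN2 hw2⟩, qIndepEntries_of_ratForm_ne_zero hw3⟩

end Fibers

section Dimension

variable {m n a b d : ℕ} {N1 : (Fin n → ℝ) → ℝ} {N2 : (Fin m → ℝ) → ℝ}

lemma le_dimH_of_volume_ne_zero {s : Set (Fin a → Fin b → ℝ)} (hs : volume s ≠ 0) :
    ((a * b : ℕ) : ℝ≥0∞) ≤ dimH s := by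
  have := isAddHaarMeasure_volume_matrix a b
  have hfr : Module.finrank ℝ (Fin a → Fin b → ℝ) = a * b := by
    simp [Module.finrank_pi_fintype]
  have h1 : (Measure.hausdorffMeasure (a * b : ℕ) :
      Measure (Fin a → Fin b → ℝ)).IsAddHaarMeasure := by
    rw [← hfr]; exact isAddHaarMeasure_hausdorffMeasure
  have h2 : (Measure.hausdorffMeasure (a * b : ℕ) : Measure (Fin a → Fin b → ℝ)) s ≠ 0 :=
    fun h => hs (Measure.absolutelyContinuous_isAddHaarMeasure volume _ h)
  have h3 := le_dimH_of_hausdorffMeasure_ne_zero (d := ((a * b : ℕ) : NNReal)) (s := s)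
    (by simpa using h2)
  simpa using h3

theorem exists_small_theta_of_fibers (hm : 0 < m) (hn : 0 < n) (hN1 : IsNorm N1)
    (hN2 : IsNorm N2)
    (L : ((Fin a → Fin b → ℝ) × ((Fin d → ℝ) × (Fin d → ℝ))) ≃L[ℝ] (Fin m → Fin n → ℝ))
    (hP : ∀ x, Dense {u | VanishesUniformly (fun w t => scaledPsi m n N1 N2 (L (x, w)) t) u})
    (hQ : ∀ x, Dense {v | VanishesUniformly
      (fun w t => scaledPsi m n N1 N2 (L (x, Prod.swap w)) t) v})
    {ε : ℝ} (hε : 0 < ε) :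
    ∃ Ω : Fin m → Fin n → ℝ, 0 < ThetaGen m n N1 N2 Ω ∧ ThetaGen m n N1 N2 Ω < ε := by
  obtain ⟨c, hc, h⟩ := exists_ae_forall_small_theta hm hn hN1 hN2 L hP hQ
  have := isAddHaarMeasure_volume_matrix a b
  obtain ⟨x, hx⟩ := h.exists
  obtain ⟨w, hw, -⟩ := hx (min c (ε / 2)) (by positivity) (min_le_left _ _)
  exact ⟨_, hw.1, hw.2.1.trans_lt ((min_le_right _ _).trans_lt (half_lt_self hε))⟩

theorem le_dimH_of_fibers (hm : 0 < m) (hn : 0 < n) (hN1 : IsNorm N1)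
    (hN2 : IsNorm N2)
    (L : ((Fin a → Fin b → ℝ) × ((Fin d → ℝ) × (Fin d → ℝ))) ≃L[ℝ] (Fin m → Fin n → ℝ))
    (hP : ∀ x, Dense {u | VanishesUniformly (fun w t => scaledPsi m n N1 N2 (L (x, w)) t) u})
    (hQ : ∀ x, Dense {v | VanishesUniformly
      (fun w t => scaledPsi m n N1 N2 (L (x, Prod.swap w)) t) v})
    {O : Set (Fin a → Fin b → ℝ)} (hO : IsOpen O) (hO' : O.Nonempty)
    (hrank : ∀ x ∈ O, ∀ w, (Matrix.of (L (x, w))).rank = min m n) :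
    ((a * b : ℕ) : ℝ≥0∞) ≤ dimH (FSset m n N1 N2 ∩
      {Ω : Fin m → Fin n → ℝ | (Matrix.of Ω).rank = min m n ∧ QIndepEntries m n Ω}) := by
  obtain ⟨c, hc, h⟩ := exists_ae_forall_small_theta hm hn hN1 hN2 L hP hQ
  have hD : 0 < DirichletSup m n N1 N2 := by
    obtain ⟨Ω, hΩ, -⟩ := exists_small_theta_of_fibers hm hn hN1 hN2 L hP hQ one_pos
    exact hΩ.trans_le (thetaGen_le_dirichletSup hm hn hN1 hN2 Ω)
  have := isAddHaarMeasure_volume_matrix a b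
  set S := FSset m n N1 N2 ∩
      {Ω : Fin m → Fin n → ℝ | (Matrix.of Ω).rank = min m n ∧ QIndepEntries m n Ω} with hS
  have hvol : volume ((fun Ω => (L.symm Ω).1) '' S) ≠ 0 := by
    intro h0
    have hsub : O ≤ᵐ[volume] ((fun Ω => (L.symm Ω).1) '' S) := by
      filter_upwards [h] with x hx hxO
      obtain ⟨w, hw, hq⟩ := hx (min c (DirichletSup m n N1 N2 / 2)) (by positivity)
        (min_le_left _ _)
      refine ⟨L (x, w), ⟨⟨?_, ?_⟩, hrank x hxO w, hq⟩, by simp⟩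
      · exact hw.2.1.trans_lt ((min_le_right _ _).trans_lt (half_lt_self hD))
      · rintro (h1 | h1)
        · exact hw.2.2 h1
        · exact hw.1.ne' h1
    exact (hO.measure_pos volume hO').ne' (le_antisymm ((measure_mono_ae hsub).trans h0.le) bot_le)
  have hlip := LipschitzWith.prod_fst.comp L.symm.lipschitz
  exact (le_dimH_of_volume_ne_zero hvol).trans (hlip.dimH_image_le S)

end Dimension

theorem infinite_of_small_pos {ι : Type*} {f : ι → ℝ}
    (h : ∀ ε : ℝ, 0 < ε → ∃ i, 0 < f i ∧ f i < ε) : {y : ℝ | ∃ i, f i = y}.Infinite := by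
  intro hfin
  have hfin' : ({y : ℝ | ∃ i, f i = y} ∩ Set.Ioi 0).Finite := hfin.inter_of_left _
  obtain ⟨i, hi, -⟩ := h 1 one_pos
  obtain ⟨y, ⟨-, hy⟩, hmin⟩ := Set.exists_min_image _ id hfin' ⟨f i, ⟨i, rfl⟩, hi⟩
  obtain ⟨j, hj, hjy⟩ := h y hy
  exact hjy.not_ge (hmin (f j) ⟨⟨j, rfl⟩, hj⟩)

section Rational

/-- Rational vectors having a common denominator `q` with `1 ≤ q * c`. -/
def rationalVectors (d : ℕ) (c : ℝ) : Set (Fin d → ℝ) :=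
  {u | ∃ q : ℕ, 0 < q ∧ 1 ≤ q * c ∧ ∀ j, ∃ z : ℤ, (q : ℝ) * u j = z}

lemma dense_rationalVectors (d : ℕ) {c : ℝ} (hc : 0 < c) : Dense (rationalVectors d c) := by
  refine Metric.dense_iff.2 fun u ε hε => ?_
  obtain ⟨q, hq⟩ := exists_nat_gt (max (1 / c) (1 / ε))
  have hq1 : 1 / c < q := (le_max_left _ _).trans_lt hq
  have hq2 : 1 / ε < q := (le_max_right _ _).trans_lt hq
  have hq0 : (0 : ℝ) < q := lt_trans (by positivity) hq1
  refine ⟨fun j => round (q * u j) / q, ?_, q, by exact_mod_cast hq0,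
    ((div_lt_iff₀ hc).1 hq1).le, fun j => ⟨round (q * u j), by field_simp⟩⟩
  rw [Metric.mem_ball, dist_pi_lt_iff hε]
  intro j
  have h1 : (round (q * u j) : ℝ) / q - u j = (round (q * u j) - q * u j) / q := by field_simp
  rw [Real.dist_eq, h1, abs_div, abs_of_pos hq0, abs_sub_comm, div_lt_iff₀ hq0]
  have := abs_sub_round (q * u j)
  have := (div_lt_iff₀ hε).1 hq2
  nlinarith

variable {m n : ℕ} {N1 : (Fin n → ℝ) → ℝ} {N2 : (Fin m → ℝ) → ℝ}

lemma scaledPsi_nonpos_of_column (hN2 : IsNorm N2) {c₁ C₁ : ℝ}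
    (h₁ : ∀ x, c₁ * ‖x‖ ≤ N1 x) (h₁' : ∀ x, N1 x ≤ C₁ * ‖x‖) {q : ℕ} (hqc : 1 ≤ q * c₁)
    (Ω : Fin m → Fin n → ℝ) (i : Fin n) (hΩ : ∀ j, ∃ z : ℤ, (q : ℝ) * Ω j i = z)
    {t : ℝ} (ht : C₁ * q ≤ t) (ht0 : 0 ≤ t) : scaledPsi m n N1 N2 Ω t ≤ 0 := by
  choose z hz using hΩ
  have hb : (fun i' => ((Pi.single i (q : ℤ) : Fin n → ℤ) i' : ℝ)) = Pi.single i (q : ℝ) := by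
    funext i'
    rcases eq_or_ne i' i with rfl | h
    · simp
    · simp [h]
  have hnorm : ‖(Pi.single i (q : ℝ) : Fin n → ℝ)‖ = q := by simp [Pi.norm_single]
  have h := psiGen_le (N1 := N1) hN2 Ω (t := t) (Pi.single i (q : ℤ)) (fun j => -z j)
    (by rw [hb]; refine le_trans ?_ (h₁ _); rw [hnorm]; linarith)
    (by rw [hb]; refine (h₁' _).trans ?_; rwa [hnorm])
  have h0 : (fun j => (∑ i', Ω j i' * ((Pi.single i (q : ℤ) : Fin n → ℤ) i' : ℝ)) +
      ((-z j : ℤ) : ℝ)) = 0 := by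
    funext j
    rw [Finset.sum_eq_single i]
    · simp only [Pi.single_eq_same, Int.cast_natCast, Int.cast_neg, Pi.zero_apply]
      linarith [hz j]
    · intro i' _ hi'; simp [hi']
    · simp
  rw [h0, (hN2.1 0).2 rfl] at h
  exact mul_nonpos_of_nonneg_of_nonpos (Real.rpow_nonneg ht0 _) h

lemma exists_scaledPsi_le_of_row {k : ℕ} {N2 : (Fin (k + 2) → ℝ) → ℝ} (hn : 0 < n)
    (hN2 : IsNorm N2) {c₁ C₁ : ℝ} (hC₁ : 0 < C₁)
    (h₁ : ∀ x, c₁ * ‖x‖ ≤ N1 x) (h₁' : ∀ x, N1 x ≤ C₁ * ‖x‖) (j : Fin (k + 2))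
    {q : ℕ} (hq : 0 < q) (hqc : 1 ≤ q * c₁) {δ : ℝ} (hδ : 0 < δ) :
    ∃ T : ℝ, ∀ Ω : Fin (k + 2) → Fin n → ℝ, (∀ i, ∃ z : ℤ, (q : ℝ) * Ω j i = z) →
      ∀ t ≥ T, scaledPsi (k + 2) n N1 N2 Ω t ≤ δ := by
  obtain ⟨C₂, hC₂, h₂⟩ := hN2.exists_le
  have hexp : 0 < (n : ℝ) / (k + 1 : ℕ) - (n : ℝ) / (k + 2 : ℕ) := by
    have : (0 : ℝ) < n := by exact_mod_cast hn
    rw [sub_pos]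
    gcongr
    omega
  have hlim := (tendsto_rpow_neg_atTop hexp).const_mul
    (2 * C₂ * (2 * (q * C₁)) ^ ((n : ℝ) / (k + 1 : ℕ)))
  rw [mul_zero, neg_sub] at hlim
  obtain ⟨T, hT⟩ := eventually_atTop.1 (hlim.eventually_le_const hδ)
  refine ⟨max T (q * C₁), fun Ω hΩ t ht => ?_⟩
  refine (scaledPsi_le_of_rows hn k.succ_pos hN2 hC₁ hC₂ h₁ h₁' h₂ j.succAbove hq hqc Ω ?_
    ((le_max_right _ _).trans ht)).trans (hT t ((le_max_left _ _).trans ht))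
  intro j' hj'
  rw [Fin.range_succAbove, Set.mem_compl_iff, not_not, Set.mem_singleton_iff] at hj'
  rwa [hj']

end Rational

/-- Matrices with two distinguished initial rows. -/
noncomputable def rowsEquiv (k n : ℕ) :
    ((Fin k → Fin n → ℝ) × ((Fin n → ℝ) × (Fin n → ℝ))) ≃L[ℝ] (Fin (k + 2) → Fin n → ℝ) :=
  LinearEquiv.toContinuousLinearEquiv
    { toFun := fun p => Matrix.vecCons p.2.1 (Matrix.vecCons p.2.2 p.1)
      invFun := fun Ω => (fun j => Ω j.succ.succ, (Ω 0, Ω 1))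
      map_add' := fun p p' => by
        funext j
        refine Fin.cases ?_ (fun j => Fin.cases ?_ (fun j => ?_) j) j <;> rfl
      map_smul' := fun c p => by
        funext j
        refine Fin.cases ?_ (fun j => Fin.cases ?_ (fun j => ?_) j) j <;> rfl
      left_inv := fun p => rfl
      right_inv := fun Ω => by
        funext j
        refine Fin.cases ?_ (fun j => Fin.cases ?_ (fun j => ?_) j) j <;> rfl }

/-- Matrices with two distinguished initial columns. -/
noncomputable def colsEquiv (m k : ℕ) :
    ((Fin m → Fin k → ℝ) × ((Fin m → ℝ) × (Fin m → ℝ))) ≃L[ℝ] (Fin m → Fin (k + 2) → ℝ) :=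
  LinearEquiv.toContinuousLinearEquiv
    { toFun := fun p j => Matrix.vecCons (p.2.1 j) (Matrix.vecCons (p.2.2 j) (p.1 j))
      invFun := fun Ω => (fun j i => Ω j i.succ.succ, (fun j => Ω j 0, fun j => Ω j 1))
      map_add' := fun p p' => by
        funext j i
        refine Fin.cases ?_ (fun i => Fin.cases ?_ (fun i => ?_) i) i <;> rfl
      map_smul' := fun c p => by
        funext j i
        refine Fin.cases ?_ (fun i => Fin.cases ?_ (fun i => ?_) i) i <;> rfl
      left_inv := fun p => rfl
      right_inv := fun Ω => by
        funext j i
        refine Fin.cases ?_ (fun i => Fin.cases ?_ (fun i => ?_) i) i <;> rfl }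

lemma dense_vanishesUniformly_of_row {k n : ℕ} {N1 : (Fin n → ℝ) → ℝ}
    {N2 : (Fin (k + 2) → ℝ) → ℝ} (hn : 0 < n) (hN1 : IsNorm N1) (hN2 : IsNorm N2)
    {V : Type*} (Φ : (Fin n → ℝ) × V → Fin (k + 2) → Fin n → ℝ) (j : Fin (k + 2))
    (hΦ : ∀ w, Φ w j = w.1) :
    Dense {u | VanishesUniformly (fun w t => scaledPsi (k + 2) n N1 N2 (Φ w) t) u} := by
  obtain ⟨c₁, hc₁, h₁⟩ := hN1.exists_ge
  obtain ⟨C₁, hC₁, h₁'⟩ := hN1.exists_le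
  refine (dense_rationalVectors n hc₁).mono ?_
  rintro u ⟨q, hq, hqc, hu⟩ δ hδ
  obtain ⟨T, hT⟩ := exists_scaledPsi_le_of_row hn hN2 hC₁ h₁ h₁' j hq hqc hδ
  exact ⟨T, fun v t ht => hT _ (by simpa only [hΦ] using hu) t ht⟩

lemma dense_vanishesUniformly_of_column {m n : ℕ} {N1 : (Fin n → ℝ) → ℝ}
    {N2 : (Fin m → ℝ) → ℝ} (hN1 : IsNorm N1) (hN2 : IsNorm N2)
    {V : Type*} (Φ : (Fin m → ℝ) × V → Fin m → Fin n → ℝ) (i : Fin n)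
    (hΦ : ∀ w j, Φ w j i = w.1 j) :
    Dense {u | VanishesUniformly (fun w t => scaledPsi m n N1 N2 (Φ w) t) u} := by
  obtain ⟨c₁, hc₁, h₁⟩ := hN1.exists_ge
  obtain ⟨C₁, hC₁, h₁'⟩ := hN1.exists_le
  refine (dense_rationalVectors m hc₁).mono ?_
  rintro u ⟨q, hq, hqc, hu⟩ δ hδ
  refine ⟨C₁ * q, fun v t ht => (scaledPsi_nonpos_of_column hN2 h₁ h₁' hqc _ i
    (by simpa only [hΦ] using hu) ht (le_trans (by positivity) ht)).trans hδ.le⟩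

lemma rank_eq_min_of_det_submatrix_ne_zero {m n r : ℕ} (hr : r = min m n)
    (A : Matrix (Fin m) (Fin n) ℝ) (f : Fin r → Fin m) (g : Fin r → Fin n)
    (h : (A.submatrix f g).det ≠ 0) : A.rank = min m n := by
  refine le_antisymm (le_min A.rank_le_height A.rank_le_width) ?_
  have h1 := Matrix.rank_of_isUnit (A.submatrix f g)
    ((Matrix.isUnit_iff_isUnit_det _).2 (isUnit_iff_ne_zero.2 h))
  rw [← hr, ← Fintype.card_fin r, ← h1]
  exact Matrix.rank_submatrix_le A f g
/-- The matrices with nonzero leading `r × r` minor form a nonempty open set. -/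
lemma isOpen_and_nonempty_leading_det_ne_zero {a b r : ℕ} (ha : r ≤ a) (hb : r ≤ b) :
    IsOpen {x : Fin a → Fin b → ℝ |
      ((Matrix.of x).submatrix (Fin.castLE ha) (Fin.castLE hb)).det ≠ 0} ∧
    {x : Fin a → Fin b → ℝ |
      ((Matrix.of x).submatrix (Fin.castLE ha) (Fin.castLE hb)).det ≠ 0}.Nonempty := by
  constructor
  · refine isOpen_ne_fun (Continuous.matrix_det ?_) continuous_const
    exact continuous_matrix fun i j => by
      simp only [Matrix.submatrix_apply, Matrix.of_apply]
      fun_prop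
  · refine ⟨fun i j => if (i : ℕ) = j then 1 else 0, ?_⟩
    have : (Matrix.of fun (i : Fin a) (j : Fin b) => if (i : ℕ) = j then (1 : ℝ) else 0).submatrix
        (Fin.castLE ha) (Fin.castLE hb) = (1 : Matrix (Fin r) (Fin r) ℝ) := by
      ext i j
      simp [Matrix.one_apply, Fin.ext_iff]
    rw [Set.mem_ofPred_eq, this, Matrix.det_one]
    exact one_ne_zero

theorem dimH_FSset_of_fibers {m n a b d : ℕ} {N1 : (Fin n → ℝ) → ℝ} {N2 : (Fin m → ℝ) → ℝ}
    (hm : 0 < m) (hn : 0 < n) (hN1 : IsNorm N1) (hN2 : IsNorm N2)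
    (L : ((Fin a → Fin b → ℝ) × ((Fin d → ℝ) × (Fin d → ℝ))) ≃L[ℝ] (Fin m → Fin n → ℝ))
    (hP : ∀ x, Dense {u | VanishesUniformly (fun w t => scaledPsi m n N1 N2 (L (x, w)) t) u})
    (hQ : ∀ x, Dense {v | VanishesUniformly
      (fun w t => scaledPsi m n N1 N2 (L (x, Prod.swap w)) t) v})
    (hab : m * n - 2 * min m n = a * b)
    (hO : 0 < a * b → ∃ O : Set (Fin a → Fin b → ℝ), IsOpen O ∧ O.Nonempty ∧
      ∀ x ∈ O, ∀ w, (Matrix.of (L (x, w))).rank = min m n) :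
    ((m * n - 2 * min m n : ℕ) : ℝ≥0∞) ≤ dimH (FSset m n N1 N2) ∧
    ((m * n - 2 * min m n : ℕ) : ℝ≥0∞) ≤ dimH (FSset m n N1 N2 ∩
      {Ω : Fin m → Fin n → ℝ | (Matrix.of Ω).rank = min m n ∧ QIndepEntries m n Ω}) ∧
    (∀ ε : ℝ, 0 < ε → ∃ Ω : Fin m → Fin n → ℝ,
      0 < ThetaGen m n N1 N2 Ω ∧ ThetaGen m n N1 N2 Ω < ε) ∧
    {y : ℝ | ∃ Ω : Fin m → Fin n → ℝ, ThetaGen m n N1 N2 Ω = y}.Infinite := by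
  have hsmall : ∀ ε : ℝ, 0 < ε → ∃ Ω : Fin m → Fin n → ℝ,
      0 < ThetaGen m n N1 N2 Ω ∧ ThetaGen m n N1 N2 Ω < ε := fun ε hε =>
    exists_small_theta_of_fibers hm hn hN1 hN2 L hP hQ hε
  have hdim : ((m * n - 2 * min m n : ℕ) : ℝ≥0∞) ≤ dimH (FSset m n N1 N2 ∩
      {Ω : Fin m → Fin n → ℝ | (Matrix.of Ω).rank = min m n ∧ QIndepEntries m n Ω}) := by
    rw [hab]
    rcases Nat.eq_zero_or_pos (a * b) with h0 | hpos
    · simp [h0]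
    · obtain ⟨O, hO, hO', hrank⟩ := hO hpos
      exact le_dimH_of_fibers hm hn hN1 hN2 L hP hQ hO hO' hrank
  exact ⟨hdim.trans (dimH_mono Set.inter_subset_left), hdim, hsmall, infinite_of_small_pos hsmall⟩

/-- for `m/n ∉ (1/2,2)` with `(m,n) ∉ {(1,3),(3,1),(2,4),(4,2)}` and
arbitrary norms: `dim_H FS_{m,n}(‖·‖₁,‖·‖₂) ≥ mn − 2·min{m,n}`; the same bound holds
restricted to matrices of full rank `min{m,n}` whose entries together with `1` are
`ℚ`-linearly independent; and the Dirichlet spectrum accumulates at `0`, in particular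
it is not finite. -/
theorem dimH_FSset_farRatio (m n : ℕ) (hm : 0 < m) (hn : 0 < n)
    (hr : 2 * m ≤ n ∨ 2 * n ≤ m)
    (hex : ¬((m = 1 ∧ n = 3) ∨ (m = 3 ∧ n = 1) ∨ (m = 2 ∧ n = 4) ∨ (m = 4 ∧ n = 2)))
    (N1 : (Fin n → ℝ) → ℝ) (N2 : (Fin m → ℝ) → ℝ)
    (hN1 : IsNorm N1) (hN2 : IsNorm N2) :
    ((m * n - 2 * min m n : ℕ) : ℝ≥0∞) ≤ dimH (FSset m n N1 N2) ∧
    ((m * n - 2 * min m n : ℕ) : ℝ≥0∞) ≤ dimH (FSset m n N1 N2 ∩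
      {Ω : Fin m → Fin n → ℝ | (Matrix.of Ω).rank = min m n ∧ QIndepEntries m n Ω}) ∧
    (∀ ε : ℝ, 0 < ε → ∃ Ω : Fin m → Fin n → ℝ,
      0 < ThetaGen m n N1 N2 Ω ∧ ThetaGen m n N1 N2 Ω < ε) ∧
    {y : ℝ | ∃ Ω : Fin m → Fin n → ℝ, ThetaGen m n N1 N2 Ω = y}.Infinite := by
  rcases hr with h | h
  · obtain ⟨k, rfl⟩ : ∃ k, n = k + 2 := ⟨n - 2, by omega⟩
    have hmin : min m (k + 2) = m := by omega
    have hab : m * (k + 2) - 2 * min m (k + 2) = m * k := by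
      rw [hmin, mul_add, mul_comm 2 m, Nat.add_sub_cancel]
    refine dimH_FSset_of_fibers hm hn hN1 hN2 (colsEquiv m k)
      (fun x => dense_vanishesUniformly_of_column hN1 hN2 _ 0 fun w j => rfl)
      (fun x => dense_vanishesUniformly_of_column hN1 hN2 _ 1 fun w j => rfl) hab ?_
    intro hpos
    have hk : 0 < k := Nat.pos_of_mul_pos_left hpos
    have hmk : m ≤ k := by omega
    obtain ⟨hO, hO'⟩ := isOpen_and_nonempty_leading_det_ne_zero le_rfl hmk
    refine ⟨_, hO, hO', fun x hx w => ?_⟩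
    exact rank_eq_min_of_det_submatrix_ne_zero hmin.symm _ (Fin.castLE le_rfl)
      (fun i => (Fin.castLE hmk i).succ.succ) hx
  · obtain ⟨k, rfl⟩ : ∃ k, m = k + 2 := ⟨m - 2, by omega⟩
    have hmin : min (k + 2) n = n := by omega
    have hab : (k + 2) * n - 2 * min (k + 2) n = k * n := by
      rw [hmin, add_mul, Nat.add_sub_cancel]
    refine dimH_FSset_of_fibers hm hn hN1 hN2 (rowsEquiv k n)
      (fun x => dense_vanishesUniformly_of_row hn hN1 hN2 _ 0 fun w => rfl)
      (fun x => dense_vanishesUniformly_of_row hn hN1 hN2 _ 1 fun w => rfl) hab ?_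
    intro hpos
    have hk : 0 < k := Nat.pos_of_mul_pos_right hpos
    have hnk : n ≤ k := by omega
    obtain ⟨hO, hO'⟩ := isOpen_and_nonempty_leading_det_ne_zero hnk le_rfl
    refine ⟨_, hO, hO', fun x hx w => ?_⟩
    exact rank_eq_min_of_det_submatrix_ne_zero hmin.symm _
      (fun i => (Fin.castLE hnk i).succ.succ) (Fin.castLE le_rfl) hx
end

section
/- Let n ≥ 2 be an integer and c ∈ [0,1]. Then there exists ξ = (ξ₁, ξ₂) ∈ ℝ² such that the set {1, ξ₁, ξ₂} is linearly independent over ℚ, limsup_{t→∞} tⁿ ψ_ξ(t) = c, and liminf_{t→∞} tⁿ ψ_ξ(t) = 0. -/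
open Filter

/-- `ψ_ξ(t)` for `ξ = (ξ₁,ξ₂) ∈ ℝ²`: the minimum of `|b₁ξ₁ + b₂ξ₂ + b₃|` over integer
vectors `(b₁,b₂,b₃) ∈ ℤ³` with `1 ≤ max(|b₁|,|b₂|) ≤ t`. -/
noncomputable def psiTwo (ξ1 ξ2 : ℝ) (t : ℝ) : ℝ :=
  sInf { r : ℝ | ∃ b1 b2 b3 : ℤ,
    (b1 ≠ 0 ∨ b2 ≠ 0) ∧ |(b1 : ℝ)| ≤ t ∧ |(b2 : ℝ)| ≤ t ∧
    r = |(b1 : ℝ) * ξ1 + (b2 : ℝ) * ξ2 + (b3 : ℝ)| }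

lemma psiTwo_comm (x y t : ℝ) : psiTwo x y t = psiTwo y x t := by
  unfold psiTwo
  congr 1
  ext r
  constructor <;>
  · rintro ⟨a, b, e, h, ha, hb, rfl⟩
    exact ⟨b, a, e, h.symm, hb, ha, by congr 1; ring⟩

lemma psiTwo_nonneg (x y t : ℝ) : 0 ≤ psiTwo x y t := by
  apply Real.sInf_nonneg
  rintro r ⟨a, b, e, -, -, -, rfl⟩
  exact abs_nonneg _

lemma psiTwo_le {x y t : ℝ} {a b e : ℤ} (h : a ≠ 0 ∨ b ≠ 0) (ha : |(a : ℝ)| ≤ t)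
    (hb : |(b : ℝ)| ≤ t) : psiTwo x y t ≤ |(a : ℝ) * x + b * y + e| := by
  refine csInf_le ⟨0, ?_⟩ ⟨a, b, e, h, ha, hb, rfl⟩
  rintro r ⟨a, b, e, -, -, -, rfl⟩
  exact abs_nonneg _

lemma le_psiTwo {x y t l : ℝ} (ht : 1 ≤ t)
    (h : ∀ a b e : ℤ, (a ≠ 0 ∨ b ≠ 0) → |(a : ℝ)| ≤ t → |(b : ℝ)| ≤ t →
      l ≤ |(a : ℝ) * x + b * y + e|) : l ≤ psiTwo x y t := by
  refine le_csInf ⟨_, 1, 0, 0, by simp, by simpa using ht, by simp; linarith, rfl⟩ ?_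
  rintro r ⟨a, b, e, h0, ha, hb, rfl⟩
  exact h a b e h0 ha hb

lemma exists_int_not_dvd_abs_sub_le {q : ℕ} (hq : 2 ≤ q) (x : ℝ) :
    ∃ p : ℤ, ¬ (q : ℤ) ∣ p ∧ |(p : ℝ) - x| ≤ 1 := by
  have h1 := Int.floor_le x
  have h2 := Int.lt_floor_add_one x
  by_cases h : (q : ℤ) ∣ ⌊x⌋
  · refine ⟨⌊x⌋ + 1, fun h' => ?_, ?_⟩
    · have h3 := (Int.dvd_add_right h).1 h'
      have := Int.le_of_dvd one_pos h3
      omega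
    · push_cast
      rw [abs_le]; constructor <;> linarith
  · refine ⟨⌊x⌋, h, ?_⟩
    rw [abs_le]; constructor <;> linarith

/-- A real number whose rational approximations with the prescribed denominators `Q j` have
errors close to the prescribed values `d j`. -/
lemma exists_real_prescribed_errors (Q : ℕ → ℕ) (d : ℕ → ℝ) (hQ : ∀ j, 2 ≤ Q j)
    (hgrow : ∀ j, 4 * Q j ≤ Q (j + 1)) (hd0 : ∀ j, 0 ≤ d j) (hd : ∀ j, d j ≤ 1 / (4 * Q j)) :
    ∃ (ξ : ℝ) (p : ℕ → ℤ), ∀ j, ¬ (Q j : ℤ) ∣ p j ∧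
      |ξ - p j / Q j - d j| ≤ 2 / Q (j + 1) := by
  choose f hf1 hf2 using fun j (x : ℝ) => exists_int_not_dvd_abs_sub_le (hQ j) x
  let p : ℕ → ℤ := fun j => Nat.rec (motive := fun _ => ℤ) (f 0 0)
    (fun j a => f (j + 1) (Q (j + 1) * (a / Q j + d j))) j
  have hp : ∀ j, p (j + 1) = f (j + 1) (Q (j + 1) * (p j / Q j + d j)) := fun j => rfl
  have hpos : ∀ j, (0 : ℝ) < Q j := fun j => by
    have := hQ j
    exact_mod_cast (by omega : 0 < Q j)
  have hg : ∀ j, 4 * (Q j : ℝ) ≤ Q (j + 1) := fun j => by exact_mod_cast hgrow j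
  have hstep : ∀ j, |(p (j + 1) : ℝ) / Q (j + 1) - (p j / Q j + d j)| ≤ 1 / Q (j + 1) := by
    intro j
    have h := hf2 (j + 1) (Q (j + 1) * (p j / Q j + d j))
    rw [← hp] at h
    have e : (p (j + 1) : ℝ) / Q (j + 1) - (p j / Q j + d j)
        = (p (j + 1) - Q (j + 1) * (p j / Q j + d j)) / Q (j + 1) := by
      rw [sub_div, mul_div_cancel_left₀ _ (hpos _).ne']
    rw [e, abs_div, abs_of_pos (hpos (j + 1))]
    gcongr
  have hdist : ∀ j, dist ((p j : ℝ) / Q j) ((p (j + 1) : ℝ) / Q (j + 1)) ≤ 1 / Q j / 2 := by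
    intro j
    have h1 := abs_le.1 (hstep j)
    have h2 := hd j
    have h3 : 1 / (Q (j + 1) : ℝ) ≤ 1 / (4 * Q j) :=
      one_div_le_one_div_of_le (by have := hpos j; positivity) (hg j)
    have h4 : 1 / (4 * (Q j : ℝ)) = 1 / Q j / 4 := by
      rw [mul_comm, ← div_div]
    have h5 := hd0 j
    have h6 : 0 < 1 / (Q j : ℝ) := one_div_pos.2 (hpos j)
    rw [dist_comm, Real.dist_eq, abs_le]
    constructor <;> linarith [h1.1, h1.2]
  have hpow : ∀ j i, (Q j : ℝ) * 2 ^ i ≤ Q (j + i) := by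
    intro j i
    induction i with
    | zero => simp
    | succ i ih =>
      have := hg (j + i)
      have := hpos (j + i)
      rw [pow_succ, ← add_assoc]
      linarith
  have hgeom : ∀ j i, dist ((p (j + i) : ℝ) / Q (j + i)) ((p (j + (i + 1)) : ℝ) / Q (j + (i + 1)))
      ≤ 1 / Q j / 2 / 2 ^ i := by
    intro j i
    refine (hdist (j + i)).trans ?_
    have h : 1 / (Q (j + i) : ℝ) ≤ 1 / (Q j * 2 ^ i) :=
      one_div_le_one_div_of_le (by have := hpos j; positivity) (hpow j i)
    have e : 1 / (Q j : ℝ) / 2 / 2 ^ i = 1 / (Q j * 2 ^ i) / 2 := by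
      rw [div_right_comm, div_div (1 : ℝ)]
    rw [e]
    linarith
  obtain ⟨ξ, hξ⟩ := cauchySeq_tendsto_of_complete
    (cauchySeq_of_le_geometric_two (f := fun i => (p i : ℝ) / Q i) (C := 1 / Q 0)
      (fun i => by simpa using hgeom 0 i))
  have hclose : ∀ j, |(p j : ℝ) / Q j - ξ| ≤ 1 / Q j := by
    intro j
    have hlim : Tendsto (fun i => (p (j + i) : ℝ) / Q (j + i)) atTop (nhds ξ) := by
      have := (tendsto_add_atTop_iff_nat j).2 hξ
      simpa only [add_comm] using this
    exact dist_le_of_le_geometric_two_of_tendsto₀ (C := 1 / (Q j : ℝ)) (hgeom j) hlim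
  refine ⟨ξ, p, fun j => ⟨?_, ?_⟩⟩
  · cases j with
    | zero => exact hf1 _ _
    | succ j => rw [hp]; exact hf1 _ _
  · have h1 := abs_le.1 (hstep j)
    have h2 := abs_le.1 (hclose (j + 1))
    have h3 : 2 / (Q (j + 1) : ℝ) = 1 / Q (j + 1) + 1 / Q (j + 1) := by ring
    rw [h3, abs_le]
    constructor <;> linarith [h1.1, h1.2, h2.1, h2.2]

/-- Two alternating real numbers whose rational approximations have prescribed errors. -/
lemma exists_periodic_prescribed_errors (q : ℕ → ℕ) (d : ℕ → ℝ) (hq : ∀ k, 2 ≤ q k)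
    (hgrow : ∀ k, 4 * q k ≤ q (k + 1)) (hd0 : ∀ k, 0 ≤ d k) (hd : ∀ k, d k ≤ 1 / (4 * q k)) :
    ∃ (z : ℕ → ℝ) (p : ℕ → ℤ), (∀ k, z (k + 2) = z k) ∧ ∀ k, ¬ (q k : ℤ) ∣ p k ∧
      |z k - p k / q k - d k| ≤ 2 / q (k + 2) := by
  choose ξ P h using fun r : ℕ => exists_real_prescribed_errors (fun j => q (r + 2 * j))
    (fun j => d (r + 2 * j)) (fun j => hq _)
    (fun j => by
      have h1 := hgrow (r + 2 * j)
      have h2 := hgrow (r + 2 * j + 1)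
      have e : r + 2 * (j + 1) = r + 2 * j + 1 + 1 := by ring
      simp only [e]
      omega)
    (fun j => hd0 _) (fun j => hd _)
  refine ⟨fun k => ξ (k % 2), fun k => P (k % 2) (k / 2), fun k => by simp, fun k => ?_⟩
  have := h (k % 2) (k / 2)
  rwa [mul_add, ← add_assoc, Nat.mod_add_div] at this

/-- If `p / q` and `P / Q` approximate `x` and `y` very well, then no nonzero integer vector of
height less than `Q` beats `(q, 0, -p)`. -/
lemma abs_sub_le_abs_linear_form {q Q : ℕ} (hq : q.Prime) (hQ : Q.Prime) (hqQ : q ≠ Q)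
    {p P : ℤ} (hp : ¬ (q : ℤ) ∣ p) (hP : ¬ (Q : ℤ) ∣ P) {x y : ℝ}
    (h : (Q : ℝ) ^ 2 * |q * x - p| + q * Q * |Q * y - P| + q * Q * |q * x - p| ≤ 1)
    {a b e : ℤ} (h0 : a ≠ 0 ∨ b ≠ 0) (ha : |(a : ℝ)| < Q) (hb : |(b : ℝ)| < Q) :
    |q * x - p| ≤ |(a : ℝ) * x + b * y + e| := by
  have hq0 : (0 : ℝ) < q := by exact_mod_cast hq.pos
  have hQ0 : (0 : ℝ) < Q := by exact_mod_cast hQ.pos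
  have hqi : Prime (q : ℤ) := Nat.prime_iff_prime_int.1 hq
  have hQi : Prime (Q : ℤ) := Nat.prime_iff_prime_int.1 hQ
  have hcop : IsCoprime (q : ℤ) (Q : ℤ) := Nat.isCoprime_iff_coprime.2 ((Nat.coprime_primes hq hQ).2 hqQ)
  by_cases hN : a * p * Q + b * P * q + e * (q * Q) = 0
  · have hqa : (q : ℤ) ∣ a := by
      have h1 : (q : ℤ) ∣ a * p * Q := ⟨-(b * P + e * Q), by linear_combination hN⟩
      exact ((hqi.dvd_or_dvd (hcop.dvd_of_dvd_mul_right h1)).resolve_right hp)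
    have hQb : (Q : ℤ) ∣ b := by
      have h1 : (Q : ℤ) ∣ b * P * q := ⟨-(a * p + e * q), by linear_combination hN⟩
      exact ((hQi.dvd_or_dvd (hcop.symm.dvd_of_dvd_mul_right h1)).resolve_right hP)
    have hb0 : b = 0 := by
      refine Int.eq_zero_of_abs_lt_dvd hQb ?_
      exact_mod_cast hb
    subst hb0
    obtain ⟨m, rfl⟩ := hqa
    have hm : m ≠ 0 := by rintro rfl; simp at h0
    have he : e = - (m * p) := by
      have hqQ0 : (q : ℤ) * Q ≠ 0 := mul_ne_zero hqi.ne_zero hQi.ne_zero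
      apply mul_right_cancel₀ hqQ0
      linear_combination hN
    have e1 : ((q * m : ℤ) : ℝ) * x + (0 : ℤ) * y + e = m * (q * x - p) := by
      rw [he]; push_cast; ring
    rw [e1, abs_mul]
    have : (1 : ℝ) ≤ |(m : ℝ)| := by exact_mod_cast Int.one_le_abs hm
    exact le_mul_of_one_le_left (abs_nonneg _) this
  · set N : ℤ := a * p * Q + b * P * q + e * (q * Q) with hNdef
    have hN1 : (1 : ℝ) ≤ |(N : ℝ)| := by exact_mod_cast Int.one_le_abs hN
    have key : (N : ℝ) = q * Q * (a * x + b * y + e) - Q * a * (q * x - p)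
        - q * b * (Q * y - P) := by
      rw [hNdef]; push_cast; ring
    have t1 : |(N : ℝ)| ≤ q * Q * |a * x + b * y + e| + Q * |(a : ℝ)| * |q * x - p|
        + q * |(b : ℝ)| * |Q * y - P| := by
      rw [key]
      refine (abs_sub _ _).trans ?_
      gcongr
      · refine (abs_sub _ _).trans ?_
        simp [abs_mul]
      · simp [abs_mul]
    have t2 : Q * |(a : ℝ)| * |q * x - p| ≤ (Q : ℝ) ^ 2 * |q * x - p| := by
      rw [sq]; gcongr
    have t3 : q * |(b : ℝ)| * |Q * y - P| ≤ q * Q * |Q * y - P| := by gcongr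
    have t4 : (q : ℝ) * Q * |q * x - p| ≤ q * Q * |a * x + b * y + e| := by linarith
    exact le_of_mul_le_mul_left t4 (by positivity)

lemma exists_fast_growing_primes (n : ℕ) :
    ∃ q : ℕ → ℕ, (∀ k, (q k).Prime) ∧ ∀ k, 20 * (k + 2) * q k ^ (n + 1) ≤ q (k + 1) := by
  choose f hf1 hf2 using Nat.exists_infinite_primes
  refine ⟨fun k => Nat.rec (motive := fun _ => ℕ) 2
    (fun k a => f (20 * (k + 2) * a ^ (n + 1))) k, fun k => ?_, fun k => hf1 _⟩
  cases k with
  | zero => exact Nat.prime_two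
  | succ k => exact hf2 _

lemma limsup_eq_of_eventually_le_of_frequently_ge {f : ℝ → ℝ} {c : ℝ} (h0 : ∀ᶠ t in atTop, 0 ≤ f t)
    (h1 : ∀ ε > 0, ∀ᶠ t in atTop, f t ≤ c + ε) (h2 : ∀ ε > 0, ∃ᶠ t in atTop, c - ε ≤ f t) :
    limsup f atTop = c := by
  have hb : IsBoundedUnder (· ≤ ·) atTop f := ⟨c + 1, h1 1 one_pos⟩
  have hb' : IsBoundedUnder (· ≥ ·) atTop f := ⟨0, h0⟩
  apply le_antisymm
  · exact le_of_forall_pos_le_add fun ε hε => limsup_le_of_le hb'.isCoboundedUnder_le (h1 ε hε)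
  · refine le_of_forall_pos_le_add fun ε hε => ?_
    have := le_limsup_of_frequently_le (h2 ε hε) hb
    linarith

lemma liminf_eq_zero_of_frequently_le {f : ℝ → ℝ} (h0 : ∀ᶠ t in atTop, 0 ≤ f t)
    (hb : IsBoundedUnder (· ≤ ·) atTop f) (h2 : ∀ ε > 0, ∃ᶠ t in atTop, f t ≤ ε) :
    liminf f atTop = 0 := by
  have hb' : IsBoundedUnder (· ≥ ·) atTop f := ⟨0, h0⟩
  apply le_antisymm
  · refine le_of_forall_pos_le_add fun ε hε => ?_
    have := liminf_le_of_frequently_le (h2 ε hε) hb'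
    linarith
  · exact le_liminf_of_le hb.isCoboundedUnder_ge h0

lemma exists_ge_mem_Ico {q : ℕ → ℕ} (hq : StrictMono q) (K : ℕ) {t : ℝ} (ht : q K ≤ t) :
    ∃ k ≥ K, (q k : ℝ) ≤ t ∧ t < q (k + 1) := by
  have hex : ∃ k, t < q k := by
    obtain ⟨m, hm⟩ := exists_nat_gt t
    exact ⟨m, hm.trans_le (by exact_mod_cast hq.le_apply)⟩
  classical
  have hspec := Nat.find_spec hex
  have hK : K < Nat.find hex := by
    have h : (q K : ℝ) < q (Nat.find hex) := ht.trans_lt hspec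
    exact hq.lt_iff_lt.1 (by exact_mod_cast h)
  obtain ⟨m, hm⟩ : ∃ m, Nat.find hex = m + 1 := ⟨Nat.find hex - 1, by omega⟩
  refine ⟨m, by omega, ?_, hm ▸ hspec⟩
  exact not_lt.1 (Nat.find_min hex (by omega : m < Nat.find hex))

lemma linearIndependent_of_int_forms_ne_zero {x y : ℝ}
    (h : ∀ a b e : ℤ, (a ≠ 0 ∨ b ≠ 0) → (a : ℝ) * x + b * y + e ≠ 0) :
    LinearIndependent ℚ ![(1 : ℝ), x, y] := by
  rw [← LinearIndependent.iff_fractionRing (R := ℤ) (K := ℚ), Fintype.linearIndependent_iff]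
  intro g hg
  simp only [Fin.sum_univ_three, zsmul_eq_mul] at hg
  simp at hg
  have hab : ¬ (g 1 ≠ 0 ∨ g 2 ≠ 0) := fun h' => h (g 1) (g 2) (g 0) h' (by linarith)
  push Not at hab
  obtain ⟨h1, h2⟩ := hab
  have h3 : g 0 = 0 := by
    rw [h1, h2] at hg
    simpa using hg
  intro i
  fin_cases i <;> assumption

/-- Points for which the minimal values of the linear form on `[q k, q (k + 1))` are explicit
numbers `L k` with `q (k + 1) ^ n * L k` tending to `c`. -/
lemma exists_pair_explicit_minima (n : ℕ) (hn : 2 ≤ n) (c : ℝ) (hc0 : 0 ≤ c) (hc1 : c ≤ 1) :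
    ∃ (x y : ℝ) (q : ℕ → ℕ) (L : ℕ → ℝ), StrictMono q ∧ (∀ k, 0 < L k) ∧
      (∀ k : ℕ, (k + 2 : ℝ) * q k ≤ q (k + 1)) ∧
      (∀ k (a b e : ℤ), (a ≠ 0 ∨ b ≠ 0) → |(a : ℝ)| < q (k + 1) → |(b : ℝ)| < q (k + 1) →
        L k ≤ |(a : ℝ) * x + b * y + e|) ∧
      (∀ k (t : ℝ), q k ≤ t → psiTwo x y t ≤ L k) ∧
      Tendsto (fun k => (q (k + 1) : ℝ) ^ n * L k) atTop (nhds c) := by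
  obtain ⟨q, hqp, hqg⟩ := exists_fast_growing_primes n
  have hq2 : ∀ k, 2 ≤ q k := fun k => (hqp k).two_le
  have hlin : ∀ k, 20 * (k + 2) * q k ≤ q (k + 1) := fun k =>
    le_trans (Nat.mul_le_mul_left _ (Nat.le_self_pow (by omega) _)) (hqg k)
  have h40 : ∀ k, 40 * q k ≤ q (k + 1) := fun k =>
    le_trans (Nat.mul_le_mul_right _ (by omega)) (hlin k)
  have hmono : StrictMono q := strictMono_nat_of_lt_succ fun k => by
    have := h40 k; have := hq2 k; omega
  have hqR : ∀ k, (2 : ℝ) ≤ q k := fun k => by exact_mod_cast hq2 k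
  have hpos : ∀ k, (0 : ℝ) < q k := fun k => by linarith [hqR k]
  have hlinR : ∀ k : ℕ, 20 * ((k : ℝ) + 2) * q k ≤ q (k + 1) := fun k => by
    exact_mod_cast hlin k
  have hgR : ∀ k : ℕ, 20 * ((k : ℝ) + 2) * q k ^ (n + 1) ≤ q (k + 1) := fun k => by
    exact_mod_cast hqg k
  set u : ℕ → ℝ := fun k => 1 / ((k : ℝ) + 2) with hu
  have hk2 : ∀ k : ℕ, (0 : ℝ) < (k : ℝ) + 2 := fun k => by positivity
  have hu0 : ∀ k, 0 < u k := fun k => one_div_pos.2 (hk2 k)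
  have hu1 : ∀ k, u k ≤ 1 / 2 := fun k =>
    one_div_le_one_div_of_le two_pos (by have : (0 : ℝ) ≤ k := k.cast_nonneg; linarith)
  have husucc : ∀ k, u (k + 1) ≤ u k := fun k =>
    one_div_le_one_div_of_le (hk2 k) (by push_cast; linarith)
  have hratio : ∀ k, 2 * ((q k : ℝ) ^ (n + 1) / q (k + 1)) ≤ u k / 10 := by
    intro k
    have h : (q k : ℝ) ^ (n + 1) / q (k + 1) ≤ u k / 20 := by
      rw [hu, div_le_iff₀ (hpos _)]
      have := hgR k
      have := hk2 k
      field_simp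
      linarith
    linarith
  set C : ℕ → ℝ := fun k => c + (1 / 2 - c) * u k with hC
  have hC0 : ∀ k, u k / 10 < C k := fun k => by
    have h1 := hu0 k; have h2 := hu1 k
    simp only [hC]; nlinarith [mul_nonneg hc0 (by linarith : 0 ≤ 1 - u k)]
  have hC1 : ∀ k, C k + 3 * (u k / 10) ≤ 1 := fun k => by
    have h1 := hu0 k; have h2 := hu1 k
    simp only [hC]
    nlinarith [mul_nonneg (by linarith : 0 ≤ 1 - c) (by linarith : 0 ≤ 1 - u k)]
  obtain ⟨z, p, hz, hp⟩ := exists_periodic_prescribed_errors q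
    (fun k => C k / (q k * q (k + 1) ^ n)) hq2
    (fun k => by have := h40 k; omega)
    (fun k => div_nonneg (by linarith [hC0 k, hu0 k]) (by have := hpos k; positivity))
    (fun k => by
      have h1 : (4 : ℝ) * q k ≤ q k * q (k + 1) ^ n := by
        rw [mul_comm]
        have h2 : (q (k + 1) : ℝ) ≤ q (k + 1) ^ n :=
          le_self_pow₀ (by linarith [hqR (k + 1)]) (by omega)
        have h3 : (40 : ℝ) * q k ≤ q (k + 1) := by exact_mod_cast h40 k
        exact mul_le_mul_of_nonneg_left (by linarith [hqR k]) (hpos k).le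
      exact div_le_div₀ zero_le_one (by linarith [hC1 k, hu0 k])
        (by have := hpos k; positivity) h1)
  set L : ℕ → ℝ := fun k => |q k * z k - p k| with hL
  have hLC : ∀ k, |(q (k + 1) : ℝ) ^ n * L k - C k| ≤ u k / 10 := by
    intro k
    have h0 := hpos k
    have h1 := hpos (k + 1)
    have h2 := hpos (k + 2)
    have e1 : (q (k + 1) : ℝ) ^ n * L k = |q (k + 1) ^ n * (q k * z k - p k)| := by
      rw [abs_mul, abs_of_pos (pow_pos h1 n)]
    have e2 : (q (k + 1) : ℝ) ^ n * (q k * z k - p k) - C k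
        = q (k + 1) ^ n * q k * (z k - p k / q k - C k / (q k * q (k + 1) ^ n)) := by
      field_simp
    have e3 : |(q (k + 1) : ℝ) ^ n * (q k * z k - p k) - C k| ≤ u k / 10 := by
      rw [e2, abs_mul, abs_of_pos (by positivity)]
      calc (q (k + 1) : ℝ) ^ n * q k * |z k - p k / q k - C k / (q k * q (k + 1) ^ n)|
          ≤ (q (k + 1) : ℝ) ^ n * q (k + 1) * (2 / q (k + 2)) := by
            gcongr
            · exact hmono.monotone (by omega)
            · exact (hp k).2
        _ = 2 * ((q (k + 1) : ℝ) ^ (n + 1) / q (k + 1 + 1)) := by rw [pow_succ]; ring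
        _ ≤ u (k + 1) / 10 := hratio (k + 1)
        _ ≤ u k / 10 := by linarith [husucc k]
    rw [e1]
    have hCp : 0 ≤ C k := by linarith [hC0 k, hu0 k]
    have e4 := (abs_abs_sub_abs_le (q (k + 1) ^ n * (q k * z k - p k)) (C k)).trans e3
    rwa [abs_of_nonneg hCp] at e4
  have hL0 : ∀ k, 0 < L k := fun k => by
    have h1 := abs_le.1 (hLC k)
    have h2 := hC0 k
    exact pos_of_mul_pos_right (by linarith [h1.1] : 0 < (q (k + 1) : ℝ) ^ n * L k)
      (pow_pos (hpos _) n).le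
  have hT1 : ∀ k, (q (k + 1) : ℝ) ^ n * L k ≤ 1 := fun k => by
    linarith [(abs_le.1 (hLC k)).2, hC1 k, hu0 k]
  have hform : ∀ k (a b e : ℤ), (a ≠ 0 ∨ b ≠ 0) → |(a : ℝ)| < q (k + 1) →
      |(b : ℝ)| < q (k + 1) → L k ≤ |(a : ℝ) * z k + b * z (k + 1) + e| := by
    intro k a b e h0 ha hb
    refine abs_sub_le_abs_linear_form (hqp k) (hqp (k + 1)) (hmono (Nat.lt_succ_self k)).ne
      (hp k).1 (hp (k + 1)).1 ?_ h0 ha hb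
    change (q (k + 1) : ℝ) ^ 2 * L k + q k * q (k + 1) * L (k + 1) + q k * q (k + 1) * L k ≤ 1
    have h0 := hpos k
    have h1 := hpos (k + 1)
    have h2 := hpos (k + 2)
    have l0 := hL0 k
    have l1 := hL0 (k + 1)
    have one : ∀ k, (1 : ℝ) ≤ q k := fun k => by linarith [hqR k]
    have a1 : (q (k + 1) : ℝ) ^ 2 * L k ≤ q (k + 1) ^ n * L k := by
      gcongr
      · exact one _
    have a2 : (q k : ℝ) * q (k + 1) * L (k + 1) ≤ u k / 10 := by
      have b1 : L (k + 1) ≤ 1 / q (k + 1 + 1) := by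
        rw [le_div_iff₀ h2, mul_comm]
        refine le_trans ?_ (hT1 (k + 1))
        gcongr
        exact le_self_pow₀ (one _) (by omega)
      calc (q k : ℝ) * q (k + 1) * L (k + 1)
          ≤ q (k + 1) * q (k + 1) * (1 / q (k + 1 + 1)) := by
            gcongr
            exact hmono.monotone (by omega)
        _ = (q (k + 1) : ℝ) ^ 2 / q (k + 1 + 1) := by ring
        _ ≤ (q (k + 1) : ℝ) ^ (n + 1) / q (k + 1 + 1) := by
            gcongr
            · exact one _
            · omega
        _ ≤ u k / 10 := by
            have := hratio (k + 1)
            have := husucc k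
            have := hu0 (k + 1)
            linarith
    have a3 : (q k : ℝ) * q (k + 1) * L k ≤ u k / 10 := by
      calc (q k : ℝ) * q (k + 1) * L k
          = q k / q (k + 1) * (q (k + 1) ^ 2 * L k) := by field_simp
        _ ≤ q k / q (k + 1) * 1 := by
            gcongr
            exact a1.trans (hT1 k)
        _ ≤ (q k : ℝ) ^ (n + 1) / q (k + 1) := by
            rw [mul_one]
            gcongr
            exact le_self_pow₀ (one _) (by omega)
        _ ≤ u k / 10 := by
            have := hratio k
            have := hu0 k
            linarith
    linarith [(abs_le.1 (hLC k)).2, hC1 k]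
  have hψ : ∀ k t, psiTwo (z k) (z (k + 1)) t = psiTwo (z 0) (z 1) t := by
    intro k t
    induction k with
    | zero => rfl
    | succ k ih => rw [hz, psiTwo_comm, ih]
  refine ⟨z 0, z 1, q, L, hmono, hL0, fun k => ?_, ?_, fun k t ht => ?_, ?_⟩
  · have := hlinR k
    have := mul_pos (hk2 k) (hpos k)
    linarith
  · intro k
    suffices H : ∀ j k, (∀ (a b e : ℤ), (a ≠ 0 ∨ b ≠ 0) → |(a : ℝ)| < q (k + 1) →
        |(b : ℝ)| < q (k + 1) → L k ≤ |(a : ℝ) * z j + b * z (j + 1) + e|) →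
        (∀ (a b e : ℤ), (a ≠ 0 ∨ b ≠ 0) → |(a : ℝ)| < q (k + 1) →
        |(b : ℝ)| < q (k + 1) → L k ≤ |(a : ℝ) * z 0 + b * z 1 + e|) from H k k (hform k)
    intro j k
    induction j with
    | zero => exact id
    | succ j ih =>
      refine fun h => ih fun a b e h0 ha hb => ?_
      have := h b a e h0.symm hb ha
      rwa [hz, add_comm ((b : ℝ) * z (j + 1))] at this
  · rw [← hψ k]
    have := psiTwo_le (x := z k) (y := z (k + 1)) (t := t) (a := q k) (b := 0) (e := -p k)
      (Or.inl (by exact_mod_cast (hqp k).ne_zero)) (by simpa using ht)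
      (by simpa using (hpos k).le.trans ht)
    simpa [hL, sub_eq_add_neg] using this
  · have hut : Tendsto u atTop (nhds 0) :=
      tendsto_const_nhds.div_atTop (tendsto_atTop_add_const_right _ _ tendsto_natCast_atTop_atTop)
    have hCt : Tendsto C atTop (nhds c) := by
      simpa [hC] using (hut.const_mul (1 / 2 - c)).const_add c
    have hdiff : Tendsto (fun k => (q (k + 1) : ℝ) ^ n * L k - C k) atTop (nhds 0) :=
      squeeze_zero_norm hLC (by simpa using hut.div_const 10)
    simpa using hdiff.add hCt

/-- for `n ≥ 2` and `c ∈ [0,1]` there exists `ξ = (ξ₁,ξ₂) ∈ ℝ²` with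
`{1,ξ₁,ξ₂}` linearly independent over `ℚ`, `limsup_{t→∞} tⁿ ψ_ξ(t) = c`, and
`liminf_{t→∞} tⁿ ψ_ξ(t) = 0`. -/
theorem exists_exact_uniform_pair (n : ℕ) (hn : 2 ≤ n) (c : ℝ)
    (hc0 : 0 ≤ c) (hc1 : c ≤ 1) :
    ∃ ξ1 ξ2 : ℝ,
      LinearIndependent ℚ ![(1 : ℝ), ξ1, ξ2] ∧
      limsup (fun t : ℝ => t ^ n * psiTwo ξ1 ξ2 t) atTop = c ∧
      liminf (fun t : ℝ => t ^ n * psiTwo ξ1 ξ2 t) atTop = 0 := by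
  obtain ⟨x, y, q, L, hmono, hL0, hratio, hform, hψ, hlim⟩ :=
    exists_pair_explicit_minima n hn c hc0 hc1
  have hqtop : Tendsto (fun k => (q k : ℝ)) atTop atTop :=
    tendsto_natCast_atTop_atTop.comp hmono.tendsto_atTop
  have hqtop' : Tendsto (fun k => (q (k + 1) : ℝ)) atTop atTop :=
    hqtop.comp (tendsto_add_atTop_nat 1)
  have h0 : ∀ᶠ t : ℝ in atTop, 0 ≤ t ^ n * psiTwo x y t := by
    filter_upwards [eventually_ge_atTop 0] with t ht
    exact mul_nonneg (pow_nonneg ht n) (psiTwo_nonneg x y t)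
  have hupper : ∀ ε > 0, ∀ᶠ t : ℝ in atTop, t ^ n * psiTwo x y t ≤ c + ε := by
    intro ε hε
    obtain ⟨K, hK⟩ := eventually_atTop.1 (hlim.eventually_le_const (by linarith : c < c + ε))
    filter_upwards [eventually_ge_atTop (q K : ℝ)] with t ht
    obtain ⟨k, hk, h1, h2⟩ := exists_ge_mem_Ico hmono K ht
    have ht0 : 0 ≤ t := (Nat.cast_nonneg _).trans h1
    refine le_trans ?_ (hK k hk)
    gcongr
    · exact psiTwo_nonneg x y t
    · exact hψ k t h1
  refine ⟨x, y, ?_, ?_, ?_⟩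
  · refine linearIndependent_of_int_forms_ne_zero fun a b e hab h => ?_
    obtain ⟨k, ha, hb⟩ := ((hqtop'.eventually_gt_atTop |(a : ℝ)|).and
      (hqtop'.eventually_gt_atTop |(b : ℝ)|)).exists
    have := hform k a b e hab ha hb
    rw [h, abs_zero] at this
    exact (hL0 k).not_ge this
  · refine limsup_eq_of_eventually_le_of_frequently_ge h0 hupper fun ε hε => ?_
    have htop : Tendsto (fun k => (q (k + 1) : ℝ) - 1) atTop atTop :=
      tendsto_atTop_add_const_right _ _ hqtop'
    have hlim' : Tendsto (fun k => (1 - 1 / (q (k + 1) : ℝ)) ^ n * (q (k + 1) ^ n * L k))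
        atTop (nhds c) := by
      have h1 : Tendsto (fun k => 1 / (q (k + 1) : ℝ)) atTop (nhds 0) :=
        tendsto_const_nhds.div_atTop hqtop'
      simpa using ((h1.const_sub 1).pow n).mul hlim
    refine htop.frequently (Eventually.frequently ?_)
    filter_upwards [hlim'.eventually_const_le (by linarith : c - ε < c),
      htop.eventually_ge_atTop 1] with k hk h1
    refine hk.trans ?_
    have hq0 : (0 : ℝ) < q (k + 1) := by linarith
    have e : (1 - 1 / (q (k + 1) : ℝ)) ^ n * (q (k + 1) ^ n * L k)
        = ((q (k + 1) : ℝ) - 1) ^ n * L k := by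
      rw [← mul_assoc, ← mul_pow, sub_mul, one_mul, one_div_mul_cancel hq0.ne']
    rw [e]
    gcongr
    exact le_psiTwo h1 fun a b e hab ha hb =>
      hform k a b e hab (by linarith) (by linarith)
  · refine liminf_eq_zero_of_frequently_le h0 ⟨c + 1, hupper 1 one_pos⟩ fun ε hε => ?_
    have hlim' : Tendsto (fun k : ℕ => 1 / ((k : ℝ) + 2) * (q (k + 1) ^ n * L k))
        atTop (nhds 0) := by
      have h1 : Tendsto (fun k : ℕ => 1 / ((k : ℝ) + 2)) atTop (nhds 0) :=
        tendsto_const_nhds.div_atTop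
          (tendsto_atTop_add_const_right _ _ tendsto_natCast_atTop_atTop)
      simpa using h1.mul hlim
    refine hqtop.frequently (Eventually.frequently ?_)
    filter_upwards [hlim'.eventually_le_const hε] with k hk
    refine le_trans ?_ hk
    have hk2 : (0 : ℝ) < (k : ℝ) + 2 := by positivity
    have hpow : ((k : ℝ) + 2) * (q k : ℝ) ^ n ≤ q (k + 1) ^ n := by
      refine le_trans ?_ (pow_le_pow_left₀ (by positivity) (hratio k) n)
      rw [mul_pow]
      gcongr
      exact le_self_pow₀ (by have : (0 : ℝ) ≤ k := k.cast_nonneg; linarith) (by omega)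
    calc (q k : ℝ) ^ n * psiTwo x y (q k) ≤ (q k : ℝ) ^ n * L k := by
          gcongr
          exact hψ k _ le_rfl
      _ = 1 / ((k : ℝ) + 2) * (((k : ℝ) + 2) * (q k : ℝ) ^ n * L k) := by field_simp
      _ ≤ 1 / ((k : ℝ) + 2) * (q (k + 1) ^ n * L k) := by
          have := hL0 k
          gcongr
end
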